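/- arXiv:1103.0712 — 2 statements merged into one kernel-verified Lean document; each statement's English description precedes it below -/
import Mathlib

section
/- Let U′ < U and V′ < V, and let (r, Ω, φ) be a C³ solution of the system (E1)–(E5), with r, Ω > 0 and r_u < 0, on the punctured rectangle 𝒟 = [U′,U] × [V′,V] ∖ {(U,V)}. Assume: (i) ∫∫_𝒟 Ω² du dv < ∞; (ii) there are 0 < r₀ ≤ R < ∞ with r₀ ≤ r(u,v) ≤ R for all (u,v) ∈ 𝒟; and (iii) there is N > 0 such that on the two past edges [U′,U] × {V′} and {U′} × [V′,V] one has 1/N < −r·r_u < N, |r·r_v| < N, |rφ| + |rφ_v| + |rφ_u| + |φ_{uu}| + |φ_{uv}| < N, ∫_{V′}^{V} ( ∂_v(φ_u+φ_v) )²(U′,v) dv < N, and |r_{uv}| + |r_{uu}| + |r_{vv}| + |∂_uΩ| + |∂_vΩ| + |log Ω²| < N. Then sup_𝒟 ( |rφ| + |log Ω²| + |r·r_v| + |r·r_u| ) < ∞, and the solution extends to a C² solution of (E1)–(E5) on the full closed rectangle [U′,U] × [V′,V]. -/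
open Real Set Filter MeasureTheory Topology

noncomputable section

/-- The triangular domain `Δ_{δ,u₀} = {(u,v) : v ≥ u₀, u₀+δ ≥ u > v}`
(first coordinate `u`, second coordinate `v`). -/
def Tri (u₀ δ : ℝ) : Set (ℝ × ℝ) := {p : ℝ × ℝ | u₀ ≤ p.2 ∧ p.2 < p.1 ∧ p.1 ≤ u₀ + δ}

/-- The weight `ρ(u,v) = (u-v)/2`. -/
def rho (p : ℝ × ℝ) : ℝ := (p.1 - p.2) / 2

/-- Partial derivative in the first (outgoing, `u`) null coordinate. -/
def pdu (f : ℝ × ℝ → ℝ) (p : ℝ × ℝ) : ℝ := deriv (fun x => f (x, p.2)) p.1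

/-- Partial derivative in the second (ingoing, `v`) null coordinate. -/
def pdv (f : ℝ × ℝ → ℝ) (p : ℝ × ℝ) : ℝ := deriv (fun y => f (p.1, y)) p.2

/-- The vector field `T = ∂_u + ∂_v`. -/
def Td (f : ℝ × ℝ → ℝ) (p : ℝ × ℝ) : ℝ := pdu f p + pdv f p

/-- The spherically symmetric Einstein–Klein–Gordon system (E1)–(E5) with
`Λ = -3/l²`, Klein–Gordon mass parameter `a`, in double null coordinates. -/
structure EKG (a l : ℝ) (S : Set (ℝ × ℝ)) (r Ω φ : ℝ × ℝ → ℝ) : Prop where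
  r_pos : ∀ p ∈ S, 0 < r p
  Ω_pos : ∀ p ∈ S, 0 < Ω p
  E1 : ∀ p ∈ S, pdu (fun q => pdu r q / (Ω q) ^ 2) p
      = -4 * π * r p * (pdu φ p) ^ 2 / (Ω p) ^ 2
  E2 : ∀ p ∈ S, pdv (fun q => pdv r q / (Ω q) ^ 2) p
      = -4 * π * r p * (pdv φ p) ^ 2 / (Ω p) ^ 2
  E3 : ∀ p ∈ S, pdv (fun q => pdu r q) p
      = -(Ω p) ^ 2 / (4 * r p) - pdu r p * pdv r p / r p
        + 2 * π * r p * a * (Ω p) ^ 2 * (φ p) ^ 2 / l ^ 2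
        - (3 / (4 * l ^ 2)) * r p * (Ω p) ^ 2
  E4 : ∀ p ∈ S, pdv (fun q => pdu (fun q' => Real.log (Ω q')) q) p
      = (Ω p) ^ 2 / (4 * (r p) ^ 2) + pdu r p * pdv r p / (r p) ^ 2
        - 4 * π * pdu φ p * pdv φ p
  E5 : ∀ p ∈ S, pdv (fun q => pdu φ q) p + (pdu r p / r p) * pdv φ p
        + (pdv r p / r p) * pdu φ p + ((Ω p) ^ 2 * a / (2 * l ^ 2)) * φ p = 0

/-- The renormalized Hawking mass `ϖ = (r/2)(1 + 4 r_u r_v/Ω²) + r³/(2l²)`. -/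
def hawk (l : ℝ) (r Ω : ℝ × ℝ → ℝ) (p : ℝ × ℝ) : ℝ :=
  (r p / 2) * (1 + 4 * pdu r p * pdv r p / (Ω p) ^ 2) + (r p) ^ 3 / (2 * l ^ 2)

/-- The closed rectangle `[A,B] × [C,E]` with its future corner `(B,E)` removed. -/
def puncturedRect (A B C E : ℝ) : Set (ℝ × ℝ) := (Icc A B ×ˢ Icc C E) \ {(B, E)}

/-- Partial derivative in the first variable within a set. -/
def Du (D : Set (ℝ × ℝ)) (f : ℝ × ℝ → ℝ) (p : ℝ × ℝ) : ℝ := fderivWithin ℝ f D p (1, 0)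

/-- Partial derivative in the second variable within a set. -/
def Dv (D : Set (ℝ × ℝ)) (f : ℝ × ℝ → ℝ) (p : ℝ × ℝ) : ℝ := fderivWithin ℝ f D p (0, 1)

section Within

variable {D : Set (ℝ × ℝ)} {f g : ℝ × ℝ → ℝ} {p : ℝ × ℝ}

lemma ContDiffOn.Du_of_le {m n : WithTop ℕ∞} (hf : ContDiffOn ℝ n f D) (hD : UniqueDiffOn ℝ D)
    (h : m + 1 ≤ n) : ContDiffOn ℝ m (Du D f) D :=
  (hf.fderivWithin hD h).clm_apply contDiffOn_const

lemma ContDiffOn.Dv_of_le {m n : WithTop ℕ∞} (hf : ContDiffOn ℝ n f D) (hD : UniqueDiffOn ℝ D)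
    (h : m + 1 ≤ n) : ContDiffOn ℝ m (Dv D f) D :=
  (hf.fderivWithin hD h).clm_apply contDiffOn_const

lemma Du_congr (h : EqOn f g D) (hp : p ∈ D) : Du D f p = Du D g p := by
  unfold Du; rw [fderivWithin_congr h (h hp)]

lemma Dv_congr (h : EqOn f g D) (hp : p ∈ D) : Dv D f p = Dv D g p := by
  unfold Dv; rw [fderivWithin_congr h (h hp)]

lemma Du_add (hD : UniqueDiffOn ℝ D) (hf : ContDiffOn ℝ 1 f D) (hg : ContDiffOn ℝ 1 g D)
    (hp : p ∈ D) : Du D (fun q => f q + g q) p = Du D f p + Du D g p := by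
  unfold Du
  rw [fderivWithin_fun_add (hD p hp) (hf.differentiableOn (by simp) p hp)
    (hg.differentiableOn (by simp) p hp)]
  rfl

lemma Dv_add (hD : UniqueDiffOn ℝ D) (hf : ContDiffOn ℝ 1 f D) (hg : ContDiffOn ℝ 1 g D)
    (hp : p ∈ D) : Dv D (fun q => f q + g q) p = Dv D f p + Dv D g p := by
  unfold Dv
  rw [fderivWithin_fun_add (hD p hp) (hf.differentiableOn (by simp) p hp)
    (hg.differentiableOn (by simp) p hp)]
  rfl

lemma Du_mul (hD : UniqueDiffOn ℝ D) (hf : ContDiffOn ℝ 1 f D) (hg : ContDiffOn ℝ 1 g D)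
    (hp : p ∈ D) : Du D (fun q => f q * g q) p = Du D f p * g p + f p * Du D g p := by
  unfold Du
  rw [fderivWithin_fun_mul (hD p hp) (hf.differentiableOn (by simp) p hp)
    (hg.differentiableOn (by simp) p hp)]
  simp [add_comm, mul_comm]

lemma Dv_mul (hD : UniqueDiffOn ℝ D) (hf : ContDiffOn ℝ 1 f D) (hg : ContDiffOn ℝ 1 g D)
    (hp : p ∈ D) : Dv D (fun q => f q * g q) p = Dv D f p * g p + f p * Dv D g p := by
  unfold Dv
  rw [fderivWithin_fun_mul (hD p hp) (hf.differentiableOn (by simp) p hp)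
    (hg.differentiableOn (by simp) p hp)]
  simp [add_comm, mul_comm]

lemma Du_comp (hD : UniqueDiffOn ℝ D) (hf : ContDiffOn ℝ 1 f D) {F : ℝ → ℝ} {c : ℝ} (hp : p ∈ D)
    (hF : HasDerivAt F c (f p)) : Du D (fun q => F (f q)) p = c * Du D f p := by
  have h := (hF.hasFDerivAt.comp_hasFDerivWithinAt p
    (hf.differentiableOn (by simp) p hp).hasFDerivWithinAt).fderivWithin (hD p hp)
  unfold Du
  rw [show (fun q => F (f q)) = F ∘ f from rfl, h]
  simp [mul_comm]

lemma Dv_comp (hD : UniqueDiffOn ℝ D) (hf : ContDiffOn ℝ 1 f D) {F : ℝ → ℝ} {c : ℝ} (hp : p ∈ D)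
    (hF : HasDerivAt F c (f p)) : Dv D (fun q => F (f q)) p = c * Dv D f p := by
  have h := (hF.hasFDerivAt.comp_hasFDerivWithinAt p
    (hf.differentiableOn (by simp) p hp).hasFDerivWithinAt).fderivWithin (hD p hp)
  unfold Dv
  rw [show (fun q => F (f q)) = F ∘ f from rfl, h]
  simp [mul_comm]

lemma Du_const (c : ℝ) : Du D (fun _ => c) p = 0 := by simp [Du]

lemma Dv_const (c : ℝ) : Dv D (fun _ => c) p = 0 := by simp [Dv]

lemma Dv_const_mul (hD : UniqueDiffOn ℝ D) (hf : ContDiffOn ℝ 1 f D) (c : ℝ)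
    (hp : p ∈ D) : Dv D (fun q => c * f q) p = c * Dv D f p := by
  rw [Dv_mul hD contDiffOn_const hf hp, Dv_const]; ring

lemma hasDerivWithinAt_Du (hf : ContDiffOn ℝ 1 f D) (hp : p ∈ D) :
    HasDerivWithinAt (fun x => f (x, p.2)) (Du D f p) {x | (x, p.2) ∈ D} p.1 := by
  have h1 := (hf.differentiableOn (by simp) p hp).hasFDerivWithinAt
  have h2 : HasDerivWithinAt (fun x : ℝ => (x, p.2)) ((1 : ℝ), (0 : ℝ)) {x | (x, p.2) ∈ D} p.1 :=
    (hasDerivWithinAt_id _ _).prodMk (hasDerivWithinAt_const _ _ _)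
  exact h1.comp_hasDerivWithinAt (x := p.1) (f := fun x : ℝ => (x, p.2)) h2 (fun x hx => hx)

lemma hasDerivWithinAt_Dv (hf : ContDiffOn ℝ 1 f D) (hp : p ∈ D) :
    HasDerivWithinAt (fun y => f (p.1, y)) (Dv D f p) {y | (p.1, y) ∈ D} p.2 := by
  have h1 := (hf.differentiableOn (by simp) p hp).hasFDerivWithinAt
  have h2 : HasDerivWithinAt (fun y : ℝ => (p.1, y)) ((0 : ℝ), (1 : ℝ)) {y | (p.1, y) ∈ D} p.2 :=
    (hasDerivWithinAt_const _ _ _).prodMk (hasDerivWithinAt_id _ _)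
  exact h1.comp_hasDerivWithinAt (x := p.2) (f := fun y : ℝ => (p.1, y)) h2 (fun x hx => hx)

lemma Du_Dv_comm (hD : UniqueDiffOn ℝ D) (hDc : D ⊆ closure (interior D))
    (hf : ContDiffOn ℝ 2 f D) (hp : p ∈ D) : Du D (Dv D f) p = Dv D (Du D f) p := by
  have h := (hf p hp).isSymmSndFDerivWithinAt (by simp) hD (hDc hp) hp
  have hd : DifferentiableWithinAt ℝ (fderivWithin ℝ f D) D p :=
    (hf.fderivWithin hD (m := 1) (by norm_num)).differentiableOn (by simp) p hp
  have key : ∀ a b : ℝ × ℝ, fderivWithin ℝ (fun q => fderivWithin ℝ f D q a) D p b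
      = fderivWithin ℝ (fderivWithin ℝ f D) D p b a := by
    intro a b
    have := (hd.hasFDerivWithinAt.clm_apply (hasFDerivWithinAt_const a p D)).fderivWithin (hD p hp)
    rw [this]; simp
  unfold Du Dv
  rw [key, key]
  exact h.eq _ _

end Within

section Rect

variable {A B C E : ℝ} {f g : ℝ × ℝ → ℝ} {p : ℝ × ℝ}

lemma puncturedRect_uniqueDiffOn (hAB : A < B) (hCE : C < E) :
    UniqueDiffOn ℝ (puncturedRect A B C E) :=
  ((uniqueDiffOn_Icc hAB).prod (uniqueDiffOn_Icc hCE)).inter isOpen_compl_singleton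

lemma mem_puncturedRect {x y : ℝ} : (x, y) ∈ puncturedRect A B C E ↔
    (A ≤ x ∧ x ≤ B) ∧ (C ≤ y ∧ y ≤ E) ∧ (x < B ∨ y < E) := by
  unfold puncturedRect
  simp only [Set.mem_sdiff, mem_prod, mem_Icc, mem_singleton_iff, Prod.mk.injEq, not_and]
  constructor
  · rintro ⟨⟨h1, h2⟩, h3⟩
    refine ⟨h1, h2, ?_⟩
    by_contra! h
    exact h3 (le_antisymm h1.2 h.1) (le_antisymm h2.2 h.2)
  · rintro ⟨h1, h2, h3⟩
    refine ⟨⟨h1, h2⟩, ?_⟩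
    rintro rfl rfl
    rcases h3 with h | h <;> exact lt_irrefl _ h

lemma Ioo_subset_puncturedRect : Ioo A B ×ˢ Ioo C E ⊆ puncturedRect A B C E := by
  rintro ⟨x, y⟩ ⟨hx, hy⟩
  exact mem_puncturedRect.2 ⟨⟨hx.1.le, hx.2.le⟩, ⟨hy.1.le, hy.2.le⟩, Or.inl hx.2⟩

lemma puncturedRect_subset_Icc : puncturedRect A B C E ⊆ Icc A B ×ˢ Icc C E := Set.sdiff_subset

lemma Icc_subset_closure_Ioo (hAB : A < B) (hCE : C < E) :
    Icc A B ×ˢ Icc C E ⊆ closure (Ioo A B ×ˢ Ioo C E) := by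
  rw [closure_prod_eq, closure_Ioo hAB.ne, closure_Ioo hCE.ne]

lemma puncturedRect_subset_closure_interior (hAB : A < B) (hCE : C < E) :
    puncturedRect A B C E ⊆ closure (interior (puncturedRect A B C E)) :=
  (puncturedRect_subset_Icc.trans (Icc_subset_closure_Ioo hAB hCE)).trans
    (closure_mono (interior_maximal Ioo_subset_puncturedRect (isOpen_Ioo.prod isOpen_Ioo)))

lemma mem_puncturedRect_of_le {u v x y : ℝ} (hp : (u, v) ∈ puncturedRect A B C E)
    (h1 : A ≤ x) (h2 : x ≤ u) (h3 : C ≤ y) (h4 : y ≤ v) : (x, y) ∈ puncturedRect A B C E := by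
  rw [mem_puncturedRect] at *
  refine ⟨⟨h1, h2.trans hp.1.2⟩, ⟨h3, h4.trans hp.2.1.2⟩, ?_⟩
  rcases hp.2.2 with h | h
  · exact Or.inl (by linarith)
  · exact Or.inr (by linarith)

lemma rect_subset_puncturedRect {u v : ℝ} (hp : (u, v) ∈ puncturedRect A B C E) :
    Icc A u ×ˢ Icc C v ⊆ puncturedRect A B C E := by
  rintro ⟨x, y⟩ ⟨hx, hy⟩
  exact mem_puncturedRect_of_le hp hx.1 hx.2 hy.1 hy.2

/-- Fundamental theorem of calculus along `u`-segments. -/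
lemma integral_Du (hAB : A < B) (hCE : C < E) (hf : ContDiffOn ℝ 1 f (puncturedRect A B C E))
    {u v : ℝ} (hp : (u, v) ∈ puncturedRect A B C E) {u₀ : ℝ} (h0 : A ≤ u₀) (h1 : u₀ ≤ u) :
    ∫ x in u₀..u, Du (puncturedRect A B C E) f (x, v) = f (u, v) - f (u₀, v) := by
  have hv := (mem_puncturedRect.1 hp).2.1
  have hmem : ∀ x ∈ Icc u₀ u, (x, v) ∈ puncturedRect A B C E := fun x hx =>
    mem_puncturedRect_of_le hp (h0.trans hx.1) hx.2 hv.1 le_rfl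
  have hline : ContinuousOn (fun x : ℝ => (x, v)) (Icc u₀ u) := by fun_prop
  have hcD : ContinuousOn (Du (puncturedRect A B C E) f) (puncturedRect A B C E) :=
    (hf.Du_of_le (puncturedRect_uniqueDiffOn hAB hCE) (m := 0) (by norm_num)).continuousOn
  apply intervalIntegral.integral_eq_sub_of_hasDerivAt_of_le h1 (f := fun x => f (x, v))
  · exact hf.continuousOn.comp hline hmem
  · intro x hx
    have := hasDerivWithinAt_Du hf (hmem x (Ioo_subset_Icc_self hx))
    refine this.hasDerivAt (mem_of_superset (Icc_mem_nhds hx.1 hx.2) hmem)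
  · refine ContinuousOn.intervalIntegrable ?_
    rw [uIcc_of_le h1]
    exact hcD.comp hline hmem

/-- Fundamental theorem of calculus along `v`-segments. -/
lemma integral_Dv (hAB : A < B) (hCE : C < E) (hf : ContDiffOn ℝ 1 f (puncturedRect A B C E))
    {u v : ℝ} (hp : (u, v) ∈ puncturedRect A B C E) {v₀ : ℝ} (h0 : C ≤ v₀) (h1 : v₀ ≤ v) :
    ∫ y in v₀..v, Dv (puncturedRect A B C E) f (u, y) = f (u, v) - f (u, v₀) := by
  have hu := (mem_puncturedRect.1 hp).1
  have hmem : ∀ y ∈ Icc v₀ v, (u, y) ∈ puncturedRect A B C E := fun y hy =>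
    mem_puncturedRect_of_le hp hu.1 le_rfl (h0.trans hy.1) hy.2
  have hline : ContinuousOn (fun y : ℝ => (u, y)) (Icc v₀ v) := by fun_prop
  have hcD : ContinuousOn (Dv (puncturedRect A B C E) f) (puncturedRect A B C E) :=
    (hf.Dv_of_le (puncturedRect_uniqueDiffOn hAB hCE) (m := 0) (by norm_num)).continuousOn
  apply intervalIntegral.integral_eq_sub_of_hasDerivAt_of_le h1 (f := fun y => f (u, y))
  · exact hf.continuousOn.comp hline hmem
  · intro y hy
    have := hasDerivWithinAt_Dv hf (hmem y (Ioo_subset_Icc_self hy))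
    refine this.hasDerivAt (mem_of_superset (Icc_mem_nhds hy.1 hy.2) hmem)
  · refine ContinuousOn.intervalIntegrable ?_
    rw [uIcc_of_le h1]
    exact hcD.comp hline hmem

lemma ContinuousOn.integrableOn_rect (hf : ContinuousOn f (puncturedRect A B C E))
    {u v : ℝ} (hp : (u, v) ∈ puncturedRect A B C E) : IntegrableOn f (Icc A u ×ˢ Icc C v) :=
  (hf.mono (rect_subset_puncturedRect hp)).integrableOn_compact (isCompact_Icc.prod isCompact_Icc)

/-- Integrals over closed rectangles as iterated integrals. -/
lemma setIntegral_rect {u v : ℝ} (hu : A ≤ u) (hv : C ≤ v)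
    (hf : IntegrableOn f (Icc A u ×ˢ Icc C v)) :
    ∫ z in Icc A u ×ˢ Icc C v, f z = ∫ x in A..u, ∫ y in C..v, f (x, y) := by
  rw [Measure.volume_eq_prod] at hf ⊢
  rw [setIntegral_prod _ hf, intervalIntegral.integral_of_le hu, integral_Icc_eq_integral_Ioc]
  congr 1
  ext x
  rw [intervalIntegral.integral_of_le hv, integral_Icc_eq_integral_Ioc]

/-- The double fundamental theorem of calculus for the mixed derivative. -/
lemma setIntegral_Dv_Du (hAB : A < B) (hCE : C < E)
    (hf : ContDiffOn ℝ 2 f (puncturedRect A B C E))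
    {u v : ℝ} (hp : (u, v) ∈ puncturedRect A B C E) :
    ∫ z in Icc A u ×ˢ Icc C v, Dv (puncturedRect A B C E) (Du (puncturedRect A B C E) f) z
      = f (u, v) - f (A, v) - f (u, C) + f (A, C) := by
  have hD := puncturedRect_uniqueDiffOn hAB hCE
  have hDu : ContDiffOn ℝ 1 (Du (puncturedRect A B C E) f) (puncturedRect A B C E) :=
    hf.Du_of_le hD (by norm_num)
  have hc : ContinuousOn (Dv (puncturedRect A B C E) (Du (puncturedRect A B C E) f))
      (puncturedRect A B C E) := (hDu.Dv_of_le hD (m := 0) (by norm_num)).continuousOn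
  have hm := mem_puncturedRect.1 hp
  rw [setIntegral_rect hm.1.1 hm.2.1.1 (hc.integrableOn_rect hp)]
  have h1 : ∀ x ∈ uIcc A u, ∫ y in C..v, Dv (puncturedRect A B C E)
      (Du (puncturedRect A B C E) f) (x, y)
      = Du (puncturedRect A B C E) f (x, v) - Du (puncturedRect A B C E) f (x, C) := by
    intro x hx
    rw [uIcc_of_le hm.1.1] at hx
    exact integral_Dv hAB hCE hDu (mem_puncturedRect_of_le hp hx.1 hx.2 hm.2.1.1 le_rfl)
      le_rfl hm.2.1.1
  have hpC : (u, C) ∈ puncturedRect A B C E :=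
    mem_puncturedRect_of_le hp hm.1.1 le_rfl le_rfl hm.2.1.1
  have h_int : ∀ w, (u, w) ∈ puncturedRect A B C E →
      IntervalIntegrable (fun x => Du (puncturedRect A B C E) f (x, w)) volume A u := by
    intro w hw
    refine ContinuousOn.intervalIntegrable ?_
    rw [uIcc_of_le hm.1.1]
    have hw' := mem_puncturedRect.1 hw
    exact hDu.continuousOn.comp (f := fun x => (x, w)) (by fun_prop)
      fun x hx => mem_puncturedRect_of_le hw hx.1 hx.2 hw'.2.1.1 le_rfl
  rw [intervalIntegral.integral_congr h1, intervalIntegral.integral_sub (h_int v hp) (h_int C hpC),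
    integral_Du hAB hCE (hf.of_le (by norm_num)) hp le_rfl hm.1.1,
    integral_Du hAB hCE (hf.of_le (by norm_num)) hpC le_rfl hm.1.1]
  ring

end Rect

/-- Boundedness of a real function on a set. -/
def Bd (D : Set (ℝ × ℝ)) (f : ℝ × ℝ → ℝ) : Prop := ∃ M, ∀ p ∈ D, |f p| ≤ M

section Estimates

variable {A B C E : ℝ} {f g h q T : ℝ × ℝ → ℝ}

lemma exists_bound_edge_v (hCE : C < E) (hf : ContinuousOn f (puncturedRect A B C E)) :
    ∃ M, ∀ x ∈ Icc A B, |f (x, C)| ≤ M := by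
  obtain ⟨M, hM⟩ := (isCompact_Icc (a := A) (b := B)).exists_bound_of_continuousOn
    (f := fun x => f (x, C)) (hf.comp (f := fun x => (x, C)) (by fun_prop)
      fun x hx => mem_puncturedRect.2 ⟨hx, ⟨le_rfl, hCE.le⟩, Or.inr hCE⟩)
  exact ⟨M, hM⟩

lemma exists_bound_edge_u (hAB : A < B) (hf : ContinuousOn f (puncturedRect A B C E)) :
    ∃ M, ∀ y ∈ Icc C E, |f (A, y)| ≤ M := by
  obtain ⟨M, hM⟩ := (isCompact_Icc (a := C) (b := E)).exists_bound_of_continuousOn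
    (f := fun y => f (A, y)) (hf.comp (f := fun y => (A, y)) (by fun_prop)
      fun x hx => mem_puncturedRect.2 ⟨⟨le_rfl, hAB.le⟩, hx, Or.inl hAB⟩)
  exact ⟨M, hM⟩

lemma measurableSet_puncturedRect : MeasurableSet (puncturedRect A B C E) :=
  (measurableSet_Icc.prod measurableSet_Icc).diff (measurableSet_singleton _)

lemma restrict_puncturedRect : (volume : Measure (ℝ × ℝ)).restrict (puncturedRect A B C E)
    = (volume.restrict (Icc A B)).prod (volume.restrict (Icc C E)) := by
  rw [Measure.prod_restrict, ← Measure.volume_eq_prod]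
  exact Measure.restrict_congr_set (sdiff_null_ae_eq_self (measure_singleton _))

/-- A function whose mixed derivative is integrable is bounded. -/
lemma Bd_of_integrableOn_mixed (hAB : A < B) (hCE : C < E)
    (hf : ContDiffOn ℝ 2 f (puncturedRect A B C E))
    (hi : IntegrableOn (Dv (puncturedRect A B C E) (Du (puncturedRect A B C E) f))
      (puncturedRect A B C E)) : Bd (puncturedRect A B C E) f := by
  obtain ⟨M1, hM1⟩ := exists_bound_edge_v hCE hf.continuousOn
  obtain ⟨M2, hM2⟩ := exists_bound_edge_u hAB hf.continuousOn
  refine ⟨M1 + M2 + M1 + ∫ z in puncturedRect A B C E,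
    ‖Dv (puncturedRect A B C E) (Du (puncturedRect A B C E) f) z‖, ?_⟩
  rintro ⟨u, v⟩ hp
  have hm := mem_puncturedRect.1 hp
  have h1 := setIntegral_Dv_Du hAB hCE hf hp
  have h2 : |∫ z in Icc A u ×ˢ Icc C v, Dv (puncturedRect A B C E)
      (Du (puncturedRect A B C E) f) z| ≤ ∫ z in puncturedRect A B C E,
      ‖Dv (puncturedRect A B C E) (Du (puncturedRect A B C E) f) z‖ :=
    (norm_integral_le_integral_norm _).trans
      (setIntegral_mono_set hi.norm (ae_of_all _ fun _ => norm_nonneg _)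
        (rect_subset_puncturedRect hp).eventuallyLE)
  rw [h1] at h2
  have e1 := hM1 u hm.1
  have e2 := hM2 v hm.2.1
  have e3 := hM1 A ⟨le_rfl, hAB.le⟩
  rw [abs_le] at *
  constructor <;> linarith [h2.1, h2.2, e1.1, e1.2, e2.1, e2.2, e3.1, e3.2]

/-- If `∂_v g` and `∂_u h` are both dominated by an integrable function then `g h` is integrable. -/
lemma integrableOn_mul_of_deriv_le (hAB : A < B) (hCE : C < E)
    (hg : ContDiffOn ℝ 1 g (puncturedRect A B C E)) (hh : ContDiffOn ℝ 1 h (puncturedRect A B C E))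
    (hT : IntegrableOn T (puncturedRect A B C E))
    (hgT : ∀ p ∈ puncturedRect A B C E, |Dv (puncturedRect A B C E) g p| ≤ T p)
    (hhT : ∀ p ∈ puncturedRect A B C E, |Du (puncturedRect A B C E) h p| ≤ T p) :
    IntegrableOn (fun p => g p * h p) (puncturedRect A B C E) := by
  obtain ⟨M1, hM1⟩ := exists_bound_edge_v hCE hg.continuousOn
  obtain ⟨M2, hM2⟩ := exists_bound_edge_u hAB hh.continuousOn
  have hmeas : AEStronglyMeasurable (fun p => g p * h p)
      (volume.restrict (puncturedRect A B C E)) :=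
    (hg.continuousOn.mul hh.continuousOn).aestronglyMeasurable measurableSet_puncturedRect
  have hTi : Integrable T ((volume.restrict (Icc A B)).prod (volume.restrict (Icc C E))) := by
    rwa [← restrict_puncturedRect]
  set F : ℝ → ℝ := fun x => M1 + ∫ y in Icc C E, ‖T (x, y)‖ with hF
  set G : ℝ → ℝ := fun y => M2 + ∫ x in Icc A B, ‖T (x, y)‖ with hG
  have hFi : Integrable F (volume.restrict (Icc A B)) :=
    (integrable_const _).add hTi.norm.integral_prod_left
  have hGi : Integrable G (volume.restrict (Icc C E)) :=
    (integrable_const _).add hTi.norm.integral_prod_right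
  have hFG := hFi.mul_prod hGi
  have ae1 : ∀ᵐ p ∂((volume.restrict (Icc A B)).prod (volume.restrict (Icc C E))),
      Integrable (fun y => T (p.1, y)) (volume.restrict (Icc C E)) :=
    Measure.quasiMeasurePreserving_fst.ae hTi.prod_right_ae
  have ae2 : ∀ᵐ p ∂((volume.restrict (Icc A B)).prod (volume.restrict (Icc C E))),
      Integrable (fun x => T (x, p.2)) (volume.restrict (Icc A B)) :=
    Measure.quasiMeasurePreserving_snd.ae hTi.prod_left_ae
  rw [IntegrableOn]
  rw [← restrict_puncturedRect] at ae1 ae2 hFG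
  refine Integrable.mono' hFG hmeas ?_
  filter_upwards [ae1, ae2, ae_restrict_mem measurableSet_puncturedRect] with p h1 h2 hp
  obtain ⟨u, v⟩ := p
  have hm := mem_puncturedRect.1 hp
  have hgF : |g (u, v)| ≤ F u := by
    have e := integral_Dv hAB hCE hg hp le_rfl hm.2.1.1
    have e2 : |∫ y in C..v, Dv (puncturedRect A B C E) g (u, y)| ≤ ∫ y in Icc C E, ‖T (u, y)‖ := by
      rw [← Real.norm_eq_abs]
      refine (intervalIntegral.norm_integral_le_integral_norm_uIoc).trans ?_
      rw [uIoc_of_le hm.2.1.1]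
      have hsub : Ioc C v ⊆ Icc C E := fun y hy => ⟨hy.1.le, hy.2.trans hm.2.1.2⟩
      refine le_trans ?_ (setIntegral_mono_set h1.norm (ae_of_all _ fun _ => norm_nonneg _)
        hsub.eventuallyLE)
      refine integral_mono_of_nonneg (ae_of_all _ fun _ => norm_nonneg _)
        (IntegrableOn.mono_set h1.norm hsub) ?_
      filter_upwards [ae_restrict_mem measurableSet_Ioc] with y hy
      exact (hgT _ (mem_puncturedRect_of_le hp hm.1.1 le_rfl hy.1.le hy.2)).trans (le_abs_self _)
    have e3 := hM1 u hm.1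
    rw [e] at e2
    simp only [hF]
    rw [abs_le] at *
    constructor <;> linarith
  have hhG : |h (u, v)| ≤ G v := by
    have e := integral_Du hAB hCE hh hp le_rfl hm.1.1
    have e2 : |∫ x in A..u, Du (puncturedRect A B C E) h (x, v)| ≤ ∫ x in Icc A B, ‖T (x, v)‖ := by
      rw [← Real.norm_eq_abs]
      refine (intervalIntegral.norm_integral_le_integral_norm_uIoc).trans ?_
      rw [uIoc_of_le hm.1.1]
      have hsub : Ioc A u ⊆ Icc A B := fun y hy => ⟨hy.1.le, hy.2.trans hm.1.2⟩
      refine le_trans ?_ (setIntegral_mono_set h2.norm (ae_of_all _ fun _ => norm_nonneg _)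
        hsub.eventuallyLE)
      refine integral_mono_of_nonneg (ae_of_all _ fun _ => norm_nonneg _)
        (IntegrableOn.mono_set h2.norm hsub) ?_
      filter_upwards [ae_restrict_mem measurableSet_Ioc] with y hy
      exact (hhT _ (mem_puncturedRect_of_le hp hy.1.le hy.2 hm.2.1.1 le_rfl)).trans (le_abs_self _)
    have e3 := hM2 v hm.2.1
    rw [e] at e2
    simp only [hG]
    rw [abs_le] at *
    constructor <;> linarith
  rw [norm_mul]
  exact mul_le_mul hgF hhG (abs_nonneg _) ((abs_nonneg _).trans hgF)

/-- Uniform bounds for the integrals over closed subrectangles give integrability. -/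
lemma integrableOn_of_bound_rect (hAB : A < B) (hf : ContinuousOn f (puncturedRect A B C E))
    (M : ℝ) (hM : ∀ u v, (u, v) ∈ puncturedRect A B C E → ∫ z in Icc A u ×ˢ Icc C v, ‖f z‖ ≤ M) :
    IntegrableOn f (puncturedRect A B C E) := by
  rcases le_or_gt C E with hCE | hCE
  swap
  · have : puncturedRect A B C E = ∅ := by
      simp [puncturedRect, Icc_eq_empty hCE.not_ge]
    simp [this]
  set b : ℕ → ℝ := fun n => B - (B - A) / (n + 2) with hb
  have hbB : ∀ n, b n < B := fun n => by
    have : 0 < (B - A) / (n + 2) := div_pos (by linarith) (by positivity)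
    simp only [hb]; linarith
  have hbA : ∀ n, A ≤ b n := fun n => by
    have : (B - A) / (n + 2) ≤ B - A :=
      div_le_self (by linarith) (by have : (0 : ℝ) ≤ n := n.cast_nonneg; linarith)
    simp only [hb]; linarith
  have hlim : Tendsto b atTop (𝓝 B) := by
    have h1 : Tendsto (fun n : ℕ => (n : ℝ) + 2) atTop atTop :=
      tendsto_atTop_add_const_right _ _ tendsto_natCast_atTop_atTop
    have := (tendsto_const_nhds (x := B)).sub (h1.const_div_atTop (B - A))
    simpa using this
  have hmem : ∀ n, (b n, E) ∈ puncturedRect A B C E := fun n =>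
    mem_puncturedRect.2 ⟨⟨hbA n, (hbB n).le⟩, ⟨hCE, le_rfl⟩, Or.inl (hbB n)⟩
  have hcover : AECover (volume.restrict (puncturedRect A B C E)) atTop
      (fun n => Icc A (b n) ×ˢ Icc C E) := by
    refine ⟨?_, fun n => measurableSet_Icc.prod measurableSet_Icc⟩
    have h1 : ∀ᵐ p ∂(volume.restrict (puncturedRect A B C E)), p.1 ≠ B := by
      rw [restrict_puncturedRect]
      refine Measure.quasiMeasurePreserving_fst.ae (p := fun x => x ≠ B) ?_
      exact ae_restrict_of_ae (by simp [ae_iff])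
    filter_upwards [h1, ae_restrict_mem measurableSet_puncturedRect] with p h1 hp
    have hp' := puncturedRect_subset_Icc hp
    have : p.1 < B := lt_of_le_of_ne hp'.1.2 h1
    filter_upwards [hlim.eventually (lt_mem_nhds this)] with n hn
    exact ⟨⟨hp'.1.1, hn.le⟩, hp'.2⟩
  have hrr : ∀ n, (volume.restrict (puncturedRect A B C E)).restrict (Icc A (b n) ×ˢ Icc C E)
      = volume.restrict (Icc A (b n) ×ˢ Icc C E) := fun n => by
    rw [Measure.restrict_restrict (measurableSet_Icc.prod measurableSet_Icc),
      inter_eq_self_of_subset_left (rect_subset_puncturedRect (hmem n))]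
  refine hcover.integrable_of_integral_norm_bounded M ?_ ?_
  · intro n
    rw [IntegrableOn, hrr]
    exact hf.integrableOn_rect (hmem n)
  · refine Eventually.of_forall fun n => ?_
    rw [hrr]
    exact hM _ _ (hmem n)

/-- A two-dimensional Grönwall estimate: solutions of `ψ_{uv} = q ψ` with integrable `q` are
bounded. -/
lemma Bd_of_mixed_eq_mul (hAB : A < B) (hCE : C < E)
    (hf : ContDiffOn ℝ 2 f (puncturedRect A B C E)) (hq : ContinuousOn q (puncturedRect A B C E))
    (hqi : IntegrableOn q (puncturedRect A B C E))
    (heq : ∀ p ∈ puncturedRect A B C E,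
      Dv (puncturedRect A B C E) (Du (puncturedRect A B C E) f) p = q p * f p) :
    Bd (puncturedRect A B C E) f := by
  obtain ⟨M1, hM1⟩ := exists_bound_edge_v hCE hf.continuousOn
  obtain ⟨M2, hM2⟩ := exists_bound_edge_u hAB hf.continuousOn
  set D0 := M1 + M2 + M1 with hD0
  refine ⟨D0 * exp (∫ z in puncturedRect A B C E, ‖q z‖), ?_⟩
  have hfq : ContinuousOn (fun z => q z * f z) (puncturedRect A B C E) := hq.mul hf.continuousOn
  have hbase : ∀ u v, (u, v) ∈ puncturedRect A B C E →
      |f (u, v)| ≤ D0 + ∫ z in Icc A u ×ˢ Icc C v, ‖q z * f z‖ := by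
    intro u v hp
    have hm := mem_puncturedRect.1 hp
    have h1 := setIntegral_Dv_Du hAB hCE hf hp
    rw [setIntegral_congr_fun (measurableSet_Icc.prod measurableSet_Icc)
      (fun z hz => heq z (rect_subset_puncturedRect hp hz))] at h1
    have h2 : |∫ z in Icc A u ×ˢ Icc C v, q z * f z| ≤ ∫ z in Icc A u ×ˢ Icc C v, ‖q z * f z‖ := by
      rw [← Real.norm_eq_abs]
      exact norm_integral_le_integral_norm _
    rw [h1] at h2
    have e1 := hM1 u hm.1
    have e2 := hM2 v hm.2.1
    have e3 := hM1 A ⟨le_rfl, hAB.le⟩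
    rw [abs_le] at *
    constructor <;> linarith [h2.1, h2.2, e1.1, e1.2, e2.1, e2.2, e3.1, e3.2]
  rintro ⟨u₁, v₁⟩ hp
  have hm := mem_puncturedRect.1 hp
  set Q : ℝ → ℝ → ℝ := fun x y => |q (max A (min x u₁), max C (min y v₁))| with hQ
  have hQc : Continuous (Function.uncurry Q) := by
    refine Continuous.abs (hq.comp_continuous (f := fun z : ℝ × ℝ =>
      (max A (min z.1 u₁), max C (min z.2 v₁))) (by fun_prop) fun z => ?_)
    exact mem_puncturedRect_of_le hp (le_max_left _ _) (max_le hm.1.1 (min_le_right _ _))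
      (le_max_left _ _) (max_le hm.2.1.1 (min_le_right _ _))
  have hQq : ∀ x y, x ∈ Icc A u₁ → y ∈ Icc C v₁ → Q x y = |q (x, y)| := by
    intro x y hx hy
    simp only [hQ, min_eq_left hx.2, min_eq_left hy.2, max_eq_right hx.1, max_eq_right hy.1]
  have hQ0 : ∀ x y, 0 ≤ Q x y := fun x y => abs_nonneg _
  set k : ℝ → ℝ := fun x => ∫ y in C..v₁, Q x y with hk
  have hkc : Continuous k := intervalIntegral.continuous_parametric_intervalIntegral_of_continuous'
    hQc _ _
  set K : ℝ → ℝ := fun x => ∫ t in A..x, k t with hK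
  have hKd : ∀ x, HasDerivAt K (k x) x := fun x =>
    intervalIntegral.integral_hasDerivAt_right (hkc.intervalIntegrable _ _)
      (hkc.stronglyMeasurableAtFilter _ _) hkc.continuousAt
  have hKc : Continuous K := continuous_iff_continuousAt.2 fun x => (hKd x).continuousAt
  have hne : (Icc A u₁ ×ˢ Icc C v₁).Nonempty := ⟨(u₁, v₁), ⟨hm.1.1, le_rfl⟩, ⟨hm.2.1.1, le_rfl⟩⟩
  obtain ⟨⟨u, v⟩, huv, hmax⟩ := (isCompact_Icc.prod isCompact_Icc).exists_isMaxOn hne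
    (f := fun z : ℝ × ℝ => |f z| * exp (-K z.1))
    (((hf.continuousOn.mono (rect_subset_puncturedRect hp)).abs).mul
      (Continuous.continuousOn (by fun_prop)))
  set m := |f (u, v)| * exp (-K u) with hmdef
  have hm0 : 0 ≤ m := by positivity
  have hle : ∀ z ∈ Icc A u₁ ×ˢ Icc C v₁, |f z| ≤ m * exp (K z.1) := by
    intro z hz
    have : |f z| * exp (-K z.1) ≤ m := hmax hz
    calc |f z| = |f z| * exp (-K z.1) * exp (K z.1) := by
          rw [mul_assoc, ← exp_add]; simp
      _ ≤ _ := mul_le_mul_of_nonneg_right this (exp_pos _).le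
  have hpuv := rect_subset_puncturedRect hp huv
  have hsub : Icc A u ×ˢ Icc C v ⊆ Icc A u ×ˢ Icc C v₁ :=
    prod_mono_right (Icc_subset_Icc_right huv.2.2)
  have hcint : Continuous (fun z : ℝ × ℝ => Q z.1 z.2 * (m * exp (K z.1))) :=
    (show Continuous (fun z : ℝ × ℝ => Q z.1 z.2) from hQc).mul (by fun_prop)
  have h_int : IntegrableOn (fun z : ℝ × ℝ => Q z.1 z.2 * (m * exp (K z.1)))
      (Icc A u ×ˢ Icc C v₁) :=
    hcint.continuousOn.integrableOn_compact (isCompact_Icc.prod isCompact_Icc)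
  have hI : ∫ z in Icc A u ×ˢ Icc C v, ‖q z * f z‖ ≤ m * exp (K u) - m := by
    calc ∫ z in Icc A u ×ˢ Icc C v, ‖q z * f z‖
        ≤ ∫ z in Icc A u ×ˢ Icc C v, Q z.1 z.2 * (m * exp (K z.1)) := by
          refine setIntegral_mono_on ((hfq.integrableOn_rect hpuv).norm) (h_int.mono_set hsub)
            (measurableSet_Icc.prod measurableSet_Icc) fun z hz => ?_
          have hz1 : z.1 ∈ Icc A u₁ := ⟨hz.1.1, hz.1.2.trans huv.1.2⟩
          have hz2 : z.2 ∈ Icc C v₁ := ⟨hz.2.1, hz.2.2.trans huv.2.2⟩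
          rw [norm_mul, hQq _ _ hz1 hz2]
          exact mul_le_mul_of_nonneg_left (hle z ⟨hz1, hz2⟩) (abs_nonneg _)
      _ ≤ ∫ z in Icc A u ×ˢ Icc C v₁, Q z.1 z.2 * (m * exp (K z.1)) :=
          setIntegral_mono_set h_int (ae_of_all _ fun z => mul_nonneg (hQ0 _ _) (by positivity))
            hsub.eventuallyLE
      _ = ∫ x in A..u, m * exp (K x) * k x := by
          rw [setIntegral_rect huv.1.1 hm.2.1.1 h_int]
          congr 1
          ext x
          change ∫ y in C..v₁, Q x y * (m * exp (K x)) = m * exp (K x) * k x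
          rw [intervalIntegral.integral_mul_const, mul_comm]
      _ = m * exp (K u) - m * exp (K A) := by
          refine intervalIntegral.integral_eq_sub_of_hasDerivAt (f := fun x => m * exp (K x))
            (fun x _ => ?_) (Continuous.intervalIntegrable (by fun_prop) _ _)
          have := ((hKd x).exp).const_mul m
          rwa [← mul_assoc] at this
      _ = m * exp (K u) - m := by simp [hK]
  have hmD : m ≤ D0 := by
    have h1 := hbase u v hpuv
    have h2 : |f (u, v)| = m * exp (K u) := by
      rw [hmdef, mul_assoc, ← exp_add]; simp
    linarith
  have hKle : K u₁ ≤ ∫ z in puncturedRect A B C E, ‖q z‖ := by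
    have h1 : K u₁ = ∫ z in Icc A u₁ ×ˢ Icc C v₁, ‖q z‖ := by
      rw [setIntegral_rect hm.1.1 hm.2.1.1 (hq.integrableOn_rect hp).norm]
      refine intervalIntegral.integral_congr fun x hx => ?_
      refine intervalIntegral.integral_congr fun y hy => ?_
      rw [uIcc_of_le hm.1.1] at hx
      rw [uIcc_of_le hm.2.1.1] at hy
      exact hQq x y hx hy
    rw [h1]
    exact setIntegral_mono_set hqi.norm (ae_of_all _ fun _ => norm_nonneg _)
        (rect_subset_puncturedRect hp).eventuallyLE
  refine (hle _ ⟨⟨hm.1.1, le_rfl⟩, ⟨hm.2.1.1, le_rfl⟩⟩).trans ?_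
  exact mul_le_mul hmD (exp_le_exp.2 hKle) (exp_pos _).le (hm0.trans hmD)

end Estimates

/-- A function of two variables together with candidates for its derivatives up to order two. -/
structure Jet where
  /-- the function -/
  f : ℝ × ℝ → ℝ
  /-- the `u`-derivative -/
  u : ℝ × ℝ → ℝ
  /-- the `v`-derivative -/
  v : ℝ × ℝ → ℝ
  /-- the second `u`-derivative -/
  uu : ℝ × ℝ → ℝ
  /-- the mixed derivative -/
  uv : ℝ × ℝ → ℝ
  /-- the second `v`-derivative -/
  vv : ℝ × ℝ → ℝ

/-- The components of a jet are the iterated partial derivatives on the set `O`. -/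
structure Jet.IsJet (J : Jet) (O : Set (ℝ × ℝ)) : Prop where
  du : ∀ p ∈ O, HasDerivAt (fun x => J.f (x, p.2)) (J.u p) p.1
  dv : ∀ p ∈ O, HasDerivAt (fun y => J.f (p.1, y)) (J.v p) p.2
  duu : ∀ p ∈ O, HasDerivAt (fun x => J.u (x, p.2)) (J.uu p) p.1
  duv : ∀ p ∈ O, HasDerivAt (fun y => J.u (p.1, y)) (J.uv p) p.2
  dvu : ∀ p ∈ O, HasDerivAt (fun x => J.v (x, p.2)) (J.uv p) p.1
  dvv : ∀ p ∈ O, HasDerivAt (fun y => J.v (p.1, y)) (J.vv p) p.2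

/-- The system (E1)–(E5) at a point, written for jets of `r`, `log Ω` and `φ`. -/
structure JetEKG (a l : ℝ) (r ω φ : Jet) (p : ℝ × ℝ) : Prop where
  e1 : r.uu p = 2 * r.u p * ω.u p - 4 * π * r.f p * (φ.u p) ^ 2
  e2 : r.vv p = 2 * r.v p * ω.v p - 4 * π * r.f p * (φ.v p) ^ 2
  e3 : r.uv p = -(exp (ω.f p)) ^ 2 / (4 * r.f p) - r.u p * r.v p / r.f p
        + 2 * π * r.f p * a * (exp (ω.f p)) ^ 2 * (φ.f p) ^ 2 / l ^ 2
        - (3 / (4 * l ^ 2)) * r.f p * (exp (ω.f p)) ^ 2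
  e4 : ω.uv p = (exp (ω.f p)) ^ 2 / (4 * (r.f p) ^ 2) + r.u p * r.v p / (r.f p) ^ 2
        - 4 * π * φ.u p * φ.v p
  e5 : φ.uv p + (r.u p / r.f p) * φ.v p + (r.v p / r.f p) * φ.u p
        + ((exp (ω.f p)) ^ 2 * a / (2 * l ^ 2)) * φ.f p = 0

section Convert

variable {O : Set (ℝ × ℝ)} {p : ℝ × ℝ}

lemma eventually_mem_line_u (hO : IsOpen O) (hp : p ∈ O) : ∀ᶠ x in 𝓝 p.1, (x, p.2) ∈ O :=
  (Continuous.continuousAt (f := fun x => (x, p.2)) (by fun_prop)).eventually (hO.mem_nhds hp)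

lemma eventually_mem_line_v (hO : IsOpen O) (hp : p ∈ O) : ∀ᶠ y in 𝓝 p.2, (p.1, y) ∈ O :=
  (Continuous.continuousAt (f := fun y => (p.1, y)) (by fun_prop)).eventually (hO.mem_nhds hp)

namespace Jet.IsJet

variable {J : Jet}

lemma pdu_eq (h : J.IsJet O) (hp : p ∈ O) : pdu J.f p = J.u p := (h.du p hp).deriv

lemma pdv_eq (h : J.IsJet O) (hp : p ∈ O) : pdv J.f p = J.v p := (h.dv p hp).deriv

lemma pdv_pdu_eq (h : J.IsJet O) (hO : IsOpen O) (hp : p ∈ O) :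
    pdv (fun q => pdu J.f q) p = J.uv p := by
  refine HasDerivAt.deriv ((h.duv p hp).congr_of_eventuallyEq ?_)
  filter_upwards [eventually_mem_line_v hO hp] with y hy
  exact h.pdu_eq hy

end Jet.IsJet

variable {a l : ℝ} {r ω φ : Jet} {Ω : ℝ × ℝ → ℝ}

lemma pdu_div_sq (hO : IsOpen O) (hr : r.IsJet O) (hω : ω.IsJet O)
    (hΩ : ∀ q ∈ O, Ω q = exp (ω.f q)) (hp : p ∈ O) :
    pdu (fun q => pdu r.f q / (Ω q) ^ 2) p
      = (r.uu p - 2 * r.u p * ω.u p) / (Ω p) ^ 2 := by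
  have h1 := (hr.duu p hp).div (((hω.du p hp).exp).pow 2) (pow_ne_zero 2 (exp_pos _).ne')
  refine (HasDerivAt.deriv (h1.congr_of_eventuallyEq ?_)).trans ?_
  · filter_upwards [eventually_mem_line_u hO hp] with y hy
    simp [hr.pdu_eq hy, hΩ _ hy]
  · rw [hΩ p hp]
    simp only [Pi.pow_apply, Prod.mk.eta]
    field_simp
    ring

lemma pdv_div_sq (hO : IsOpen O) (hr : r.IsJet O) (hω : ω.IsJet O)
    (hΩ : ∀ q ∈ O, Ω q = exp (ω.f q)) (hp : p ∈ O) :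
    pdv (fun q => pdv r.f q / (Ω q) ^ 2) p
      = (r.vv p - 2 * r.v p * ω.v p) / (Ω p) ^ 2 := by
  have h1 := (hr.dvv p hp).div (((hω.dv p hp).exp).pow 2) (pow_ne_zero 2 (exp_pos _).ne')
  refine (HasDerivAt.deriv (h1.congr_of_eventuallyEq ?_)).trans ?_
  · filter_upwards [eventually_mem_line_v hO hp] with y hy
    simp [hr.pdv_eq hy, hΩ _ hy]
  · rw [hΩ p hp]
    simp only [Pi.pow_apply, Prod.mk.eta]
    field_simp
    ring

lemma pdv_pdu_log (hO : IsOpen O) (hω : ω.IsJet O)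
    (hΩ : ∀ q ∈ O, Ω q = exp (ω.f q)) (hp : p ∈ O) :
    pdv (fun q => pdu (fun q' => Real.log (Ω q')) q) p = ω.uv p := by
  have h1 : ∀ q ∈ O, pdu (fun q' => Real.log (Ω q')) q = ω.u q := by
    intro q hq
    refine HasDerivAt.deriv ((hω.du q hq).congr_of_eventuallyEq ?_)
    filter_upwards [eventually_mem_line_u hO hq] with y hy
    simp [hΩ _ hy]
  refine HasDerivAt.deriv ((hω.duv p hp).congr_of_eventuallyEq ?_)
  filter_upwards [eventually_mem_line_v hO hp] with y hy
  exact h1 _ hy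

/-- On subsets of an open set where all jets are honest, the system `EKG` is the jet system. -/
lemma EKG_iff {S : Set (ℝ × ℝ)} (hO : IsOpen O) (hS : S ⊆ O) (hr : r.IsJet O) (hω : ω.IsJet O)
    (hφ : φ.IsJet O) (hΩ : ∀ q ∈ O, Ω q = exp (ω.f q)) (hpos : ∀ q ∈ S, 0 < r.f q) :
    EKG a l S r.f Ω φ.f ↔ ∀ p ∈ S, JetEKG a l r ω φ p := by
  have hΩp : ∀ p ∈ S, 0 < Ω p := fun p hp => by rw [hΩ p (hS hp)]; exact exp_pos _
  have k1 : ∀ p ∈ S, pdu (fun q => pdu r.f q / (Ω q) ^ 2) p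
      = -4 * π * r.f p * (pdu φ.f p) ^ 2 / (Ω p) ^ 2 ↔
      r.uu p = 2 * r.u p * ω.u p - 4 * π * r.f p * (φ.u p) ^ 2 := by
    intro p hp
    rw [pdu_div_sq hO hr hω hΩ (hS hp), hφ.pdu_eq (hS hp),
      div_left_inj' (pow_ne_zero 2 (hΩp p hp).ne')]
    constructor <;> intro h <;> linarith
  have k2 : ∀ p ∈ S, pdv (fun q => pdv r.f q / (Ω q) ^ 2) p
      = -4 * π * r.f p * (pdv φ.f p) ^ 2 / (Ω p) ^ 2 ↔
      r.vv p = 2 * r.v p * ω.v p - 4 * π * r.f p * (φ.v p) ^ 2 := by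
    intro p hp
    rw [pdv_div_sq hO hr hω hΩ (hS hp), hφ.pdv_eq (hS hp),
      div_left_inj' (pow_ne_zero 2 (hΩp p hp).ne')]
    constructor <;> intro h <;> linarith
  constructor
  · intro h p hp
    have hp' := hS hp
    have h3 := h.E3 p hp
    have h4 := h.E4 p hp
    have h5 := h.E5 p hp
    rw [hr.pdv_pdu_eq hO hp', hr.pdu_eq hp', hr.pdv_eq hp', hΩ p hp'] at h3
    rw [pdv_pdu_log hO hω hΩ hp', hr.pdu_eq hp', hr.pdv_eq hp', hφ.pdu_eq hp', hφ.pdv_eq hp',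
      hΩ p hp'] at h4
    rw [hφ.pdv_pdu_eq hO hp', hr.pdu_eq hp', hr.pdv_eq hp', hφ.pdu_eq hp', hφ.pdv_eq hp',
      hΩ p hp'] at h5
    exact ⟨(k1 p hp).1 (h.E1 p hp), (k2 p hp).1 (h.E2 p hp), h3, h4, h5⟩
  · intro h
    refine ⟨hpos, hΩp, fun p hp => (k1 p hp).2 (h p hp).e1, fun p hp => (k2 p hp).2 (h p hp).e2,
      fun p hp => ?_, fun p hp => ?_, fun p hp => ?_⟩
    all_goals have hp' := hS hp
    · rw [hr.pdv_pdu_eq hO hp', hr.pdu_eq hp', hr.pdv_eq hp', hΩ p hp']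
      exact (h p hp).e3
    · rw [pdv_pdu_log hO hω hΩ hp', hr.pdu_eq hp', hr.pdv_eq hp', hφ.pdu_eq hp', hφ.pdv_eq hp',
        hΩ p hp']
      exact (h p hp).e4
    · rw [hφ.pdv_pdu_eq hO hp', hr.pdu_eq hp', hr.pdv_eq hp', hφ.pdu_eq hp', hφ.pdv_eq hp',
        hΩ p hp']
      exact (h p hp).e5

end Convert

/-- The jet of a function given by its iterated derivatives within a set. -/
def jetWithin (D : Set (ℝ × ℝ)) (f : ℝ × ℝ → ℝ) : Jet where
  f := f
  u := Du D f
  v := Dv D f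
  uu := Du D (Du D f)
  uv := Dv D (Du D f)
  vv := Dv D (Dv D f)

section JetWithin

variable {A B C E : ℝ} {D : Set (ℝ × ℝ)} {f : ℝ × ℝ → ℝ} {p : ℝ × ℝ}

lemma hasDerivAt_Du (hf : ContDiffOn ℝ 1 f D) (hp : p ∈ interior D) :
    HasDerivAt (fun x => f (x, p.2)) (Du D f p) p.1 := by
  refine (hasDerivWithinAt_Du hf (interior_subset hp)).hasDerivAt ?_
  filter_upwards [eventually_mem_line_u isOpen_interior hp] with x hx using interior_subset hx

lemma hasDerivAt_Dv (hf : ContDiffOn ℝ 1 f D) (hp : p ∈ interior D) :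
    HasDerivAt (fun y => f (p.1, y)) (Dv D f p) p.2 := by
  refine (hasDerivWithinAt_Dv hf (interior_subset hp)).hasDerivAt ?_
  filter_upwards [eventually_mem_line_v isOpen_interior hp] with x hx using interior_subset hx

lemma isJet_jetWithin (hD : UniqueDiffOn ℝ D) (hDc : D ⊆ closure (interior D))
    (hf : ContDiffOn ℝ 2 f D) : (jetWithin D f).IsJet (interior D) := by
  have h1 : ContDiffOn ℝ 1 f D := hf.of_le (by norm_num)
  have hu : ContDiffOn ℝ 1 (Du D f) D := hf.Du_of_le hD (by norm_num)
  have hv : ContDiffOn ℝ 1 (Dv D f) D := hf.Dv_of_le hD (by norm_num)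
  refine ⟨fun p hp => hasDerivAt_Du h1 hp, fun p hp => hasDerivAt_Dv h1 hp,
    fun p hp => hasDerivAt_Du hu hp, fun p hp => hasDerivAt_Dv hu hp, fun p hp => ?_,
    fun p hp => hasDerivAt_Dv hv hp⟩
  have := hasDerivAt_Du hv hp
  rwa [Du_Dv_comm hD hDc hf (interior_subset hp)] at this

/-- The components of a jet are continuous on a set. -/
structure Jet.ContOn (J : Jet) (S : Set (ℝ × ℝ)) : Prop where
  f : ContinuousOn J.f S
  u : ContinuousOn J.u S
  v : ContinuousOn J.v S
  uu : ContinuousOn J.uu S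
  uv : ContinuousOn J.uv S
  vv : ContinuousOn J.vv S

lemma contOn_jetWithin (hD : UniqueDiffOn ℝ D) (hf : ContDiffOn ℝ 2 f D) :
    (jetWithin D f).ContOn D := by
  have hu : ContDiffOn ℝ 1 (Du D f) D := hf.Du_of_le hD (by norm_num)
  have hv : ContDiffOn ℝ 1 (Dv D f) D := hf.Dv_of_le hD (by norm_num)
  exact ⟨hf.continuousOn, hu.continuousOn, hv.continuousOn,
    (hu.Du_of_le hD (m := 0) (by norm_num)).continuousOn,
    (hu.Dv_of_le hD (m := 0) (by norm_num)).continuousOn,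
    (hv.Dv_of_le hD (m := 0) (by norm_num)).continuousOn⟩

/-- The jet system passes to limits. -/
lemma JetEKG.of_closure {a l : ℝ} {r ω φ : Jet} {S T : Set (ℝ × ℝ)} (hST : S ⊆ T)
    (hTS : T ⊆ closure S)
    (hr : r.ContOn T) (hω : ω.ContOn T) (hφ : φ.ContOn T) (hpos : ∀ p ∈ T, r.f p ≠ 0)
    (h : ∀ p ∈ S, JetEKG a l r ω φ p) : ∀ p ∈ T, JetEKG a l r ω φ p := by
  have key : ∀ F G : ℝ × ℝ → ℝ, ContinuousOn F T → ContinuousOn G T → (∀ p ∈ S, F p = G p) →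
      ∀ p ∈ T, F p = G p := fun F G hF hG hFG p hp =>
    Set.EqOn.of_subset_closure (s := S) (t := T) hFG hF hG hST hTS hp
  have ⟨r0, r1, r2, r3, r4, r5⟩ := hr
  have ⟨w0, w1, w2, w3, w4, w5⟩ := hω
  have ⟨f0, f1, f2, f3, f4, f5⟩ := hφ
  have ew : ContinuousOn (fun p => exp (ω.f p) ^ 2) T := w0.rexp.pow 2
  have h4 : ∀ p ∈ T, 4 * r.f p ≠ 0 := fun p hp => mul_ne_zero (by norm_num) (hpos p hp)
  have h42 : ∀ p ∈ T, 4 * r.f p ^ 2 ≠ 0 := fun p hp =>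
    mul_ne_zero (by norm_num) (pow_ne_zero 2 (hpos p hp))
  have h2 : ∀ p ∈ T, r.f p ^ 2 ≠ 0 := fun p hp => pow_ne_zero 2 (hpos p hp)
  have g1 := key _ _ r3 (by fun_prop) fun p hp => (h p hp).e1
  have g2 := key _ _ r5 (by fun_prop) fun p hp => (h p hp).e2
  have g3 := key _ _ r4 (by fun_prop (disch := assumption)) fun p hp => (h p hp).e3
  have g4 := key _ _ w4 (by fun_prop (disch := assumption)) fun p hp => (h p hp).e4
  have g5 := key _ _ (by fun_prop (disch := assumption)) continuousOn_const fun p hp => (h p hp).e5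
  exact fun p hp => ⟨g1 p hp, g2 p hp, g3 p hp, g4 p hp, g5 p hp⟩

/-- A solution of the system on the punctured rectangle satisfies the jet system there. -/
lemma EKG.jetEKG {a l : ℝ} {r Ω φ : ℝ × ℝ → ℝ} (hAB : A < B) (hCE : C < E)
    (hr : ContDiffOn ℝ 2 r (puncturedRect A B C E)) (hΩ : ContDiffOn ℝ 2 Ω (puncturedRect A B C E))
    (hφ : ContDiffOn ℝ 2 φ (puncturedRect A B C E)) (h : EKG a l (puncturedRect A B C E) r Ω φ) :
    ∀ p ∈ puncturedRect A B C E, JetEKG a l (jetWithin (puncturedRect A B C E) r)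
      (jetWithin (puncturedRect A B C E) fun q => log (Ω q))
      (jetWithin (puncturedRect A B C E) φ) p := by
  set D := puncturedRect A B C E
  have hD : UniqueDiffOn ℝ D := puncturedRect_uniqueDiffOn hAB hCE
  have hDc : D ⊆ closure (interior D) := puncturedRect_subset_closure_interior hAB hCE
  have hω : ContDiffOn ℝ 2 (fun q => log (Ω q)) D := hΩ.log fun p hp => (h.Ω_pos p hp).ne'
  refine JetEKG.of_closure interior_subset hDc (contOn_jetWithin hD hr) (contOn_jetWithin hD hω)
    (contOn_jetWithin hD hφ) (fun p hp => (h.r_pos p hp).ne') ?_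
  refine (EKG_iff (Ω := Ω) isOpen_interior le_rfl (isJet_jetWithin hD hDc hr)
    (isJet_jetWithin hD hDc hω) (isJet_jetWithin hD hDc hφ)
    (fun q hq => (exp_log (h.Ω_pos q (interior_subset hq))).symm)
    fun q hq => h.r_pos q (interior_subset hq)).1 ?_
  exact ⟨fun p hp => h.r_pos p (interior_subset hp), fun p hp => h.Ω_pos p (interior_subset hp),
    fun p hp => h.E1 p (interior_subset hp), fun p hp => h.E2 p (interior_subset hp),
    fun p hp => h.E3 p (interior_subset hp), fun p hp => h.E4 p (interior_subset hp),
    fun p hp => h.E5 p (interior_subset hp)⟩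

end JetWithin

section BdLemmas

variable {D : Set (ℝ × ℝ)} {f g : ℝ × ℝ → ℝ}

lemma Bd.congr (hf : Bd D f) (h : ∀ p ∈ D, g p = f p) : Bd D g := by
  obtain ⟨M, hM⟩ := hf
  exact ⟨M, fun p hp => by rw [h p hp]; exact hM p hp⟩

lemma Bd.add (hf : Bd D f) (hg : Bd D g) : Bd D (fun p => f p + g p) := by
  obtain ⟨M, hM⟩ := hf
  obtain ⟨K, hK⟩ := hg
  exact ⟨M + K, fun p hp => (abs_add_le _ _).trans (add_le_add (hM p hp) (hK p hp))⟩

lemma Bd.mul (hf : Bd D f) (hg : Bd D g) : Bd D (fun p => f p * g p) := by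
  obtain ⟨M, hM⟩ := hf
  obtain ⟨K, hK⟩ := hg
  refine ⟨M * K, fun p hp => ?_⟩
  rw [abs_mul]
  exact mul_le_mul (hM p hp) (hK p hp) (abs_nonneg _) ((abs_nonneg _).trans (hM p hp))

lemma Bd.const (c : ℝ) : Bd D (fun _ => c) := ⟨|c|, fun _ _ => le_rfl⟩

lemma Bd.const_mul (c : ℝ) (hf : Bd D f) : Bd D (fun p => c * f p) := (Bd.const c).mul hf

lemma Bd.neg (hf : Bd D f) : Bd D (fun p => -f p) := by
  obtain ⟨M, hM⟩ := hf
  exact ⟨M, fun p hp => by rw [abs_neg]; exact hM p hp⟩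

lemma Bd.sub (hf : Bd D f) (hg : Bd D g) : Bd D (fun p => f p - g p) := by
  simpa only [sub_eq_add_neg] using hf.add hg.neg

lemma Bd.inv {c : ℝ} (hc : 0 < c) (h : ∀ p ∈ D, c ≤ f p) : Bd D (fun p => (f p)⁻¹) :=
  ⟨c⁻¹, fun p hp => by
    rw [abs_of_pos (inv_pos.2 (hc.trans_le (h p hp)))]
    exact inv_anti₀ hc (h p hp)⟩

lemma Bd.exp (hf : Bd D f) : Bd D (fun p => exp (f p)) := by
  obtain ⟨M, hM⟩ := hf
  exact ⟨Real.exp M, fun p hp => by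
    rw [abs_of_pos (exp_pos _)]
    exact exp_le_exp.2 ((le_abs_self _).trans (hM p hp))⟩

lemma MeasureTheory.IntegrableOn.of_abs_le (hD : MeasurableSet D) (hg : IntegrableOn g D)
    (hf : ContinuousOn f D) (h : ∀ p ∈ D, |f p| ≤ g p) : IntegrableOn f D := by
  refine Integrable.mono' hg (hf.aestronglyMeasurable hD) ?_
  filter_upwards [ae_restrict_mem hD] with p hp using h p hp

lemma MeasureTheory.IntegrableOn.bd_mul (hD : MeasurableSet D) (hg : IntegrableOn g D)
    (hgc : ContinuousOn g D) (hfc : ContinuousOn f D) (hf : Bd D f) :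
    IntegrableOn (fun p => f p * g p) D := by
  obtain ⟨M, hM⟩ := hf
  refine IntegrableOn.of_abs_le hD (hg.norm.const_mul M) (hfc.mul hgc) fun p hp => ?_
  rw [abs_mul]
  exact mul_le_mul_of_nonneg_right (hM p hp) (abs_nonneg _)

variable {A B C E : ℝ}

lemma Bd_of_Bd_Dv (hAB : A < B) (hCE : C < E) (hf : ContDiffOn ℝ 1 f (puncturedRect A B C E))
    (h : Bd (puncturedRect A B C E) (Dv (puncturedRect A B C E) f)) :
    Bd (puncturedRect A B C E) f := by
  obtain ⟨M1, hM1⟩ := exists_bound_edge_v hCE hf.continuousOn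
  obtain ⟨M, hM⟩ := h
  refine ⟨M1 + M * (E - C), ?_⟩
  rintro ⟨u, v⟩ hp
  have hm := mem_puncturedRect.1 hp
  have e := integral_Dv hAB hCE hf hp le_rfl hm.2.1.1
  have hM0 : 0 ≤ M := (abs_nonneg _).trans (hM _ hp)
  have e2 := intervalIntegral.norm_integral_le_of_norm_le_const (a := C) (b := v) (C := M)
    (f := fun y => Dv (puncturedRect A B C E) f (u, y)) fun y hy => by
      rw [uIoc_of_le hm.2.1.1] at hy
      exact hM _ (mem_puncturedRect_of_le hp hm.1.1 le_rfl hy.1.le hy.2)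
  rw [e, Real.norm_eq_abs, abs_of_nonneg (sub_nonneg.2 hm.2.1.1)] at e2
  have e3 := hM1 u hm.1
  have e4 : M * (v - C) ≤ M * (E - C) := mul_le_mul_of_nonneg_left (by linarith [hm.2.1.2]) hM0
  rw [abs_le] at *
  constructor <;> linarith

lemma Bd_of_Bd_Du (hAB : A < B) (hCE : C < E) (hf : ContDiffOn ℝ 1 f (puncturedRect A B C E))
    (h : Bd (puncturedRect A B C E) (Du (puncturedRect A B C E) f)) :
    Bd (puncturedRect A B C E) f := by
  obtain ⟨M1, hM1⟩ := exists_bound_edge_u hAB hf.continuousOn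
  obtain ⟨M, hM⟩ := h
  refine ⟨M1 + M * (B - A), ?_⟩
  rintro ⟨u, v⟩ hp
  have hm := mem_puncturedRect.1 hp
  have e := integral_Du hAB hCE hf hp le_rfl hm.1.1
  have hM0 : 0 ≤ M := (abs_nonneg _).trans (hM _ hp)
  have e2 := intervalIntegral.norm_integral_le_of_norm_le_const (a := A) (b := u) (C := M)
    (f := fun x => Du (puncturedRect A B C E) f (x, v)) fun x hx => by
      rw [uIoc_of_le hm.1.1] at hx
      exact hM _ (mem_puncturedRect_of_le hp hx.1.le hx.2 hm.2.1.1 le_rfl)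
  rw [e, Real.norm_eq_abs, abs_of_nonneg (sub_nonneg.2 hm.1.1)] at e2
  have e3 := hM1 v hm.2.1
  have e4 : M * (u - A) ≤ M * (B - A) := mul_le_mul_of_nonneg_left (by linarith [hm.1.2]) hM0
  rw [abs_le] at *
  constructor <;> linarith

end BdLemmas

/-- A `C³` solution on a punctured rectangle, in terms of `ω = log Ω`, with two-sided bounds on the
area radius and finite spacetime volume. -/
structure InteriorSol (a l A B C E r₀ R : ℝ) (r ω φ : ℝ × ℝ → ℝ) : Prop where
  lt_u : A < B
  lt_v : C < E
  l_ne : l ≠ 0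
  contDiffOn_r : ContDiffOn ℝ 3 r (puncturedRect A B C E)
  contDiffOn_ω : ContDiffOn ℝ 3 ω (puncturedRect A B C E)
  contDiffOn_φ : ContDiffOn ℝ 3 φ (puncturedRect A B C E)
  sys : ∀ p ∈ puncturedRect A B C E, JetEKG a l (jetWithin (puncturedRect A B C E) r)
    (jetWithin (puncturedRect A B C E) ω) (jetWithin (puncturedRect A B C E) φ) p
  r₀_pos : 0 < r₀
  le_r : ∀ p ∈ puncturedRect A B C E, r₀ ≤ r p
  r_le : ∀ p ∈ puncturedRect A B C E, r p ≤ R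
  vol : IntegrableOn (fun p => exp (ω p) ^ 2) (puncturedRect A B C E)

/-- The source in the wave equation `(r²/2)_{uv} = source`. -/
def source (a l : ℝ) (r ω φ : ℝ × ℝ → ℝ) (p : ℝ × ℝ) : ℝ :=
  exp (ω p) ^ 2 * (-(1 / 4) + 2 * π * a / l ^ 2 * (r p * φ p) ^ 2 - 3 / (4 * l ^ 2) * (r p) ^ 2)

/-- The potential in the wave equation `(rφ)_{uv} = potential * rφ`. -/
def potential (a l : ℝ) (D : Set (ℝ × ℝ)) (r ω φ : ℝ × ℝ → ℝ) (p : ℝ × ℝ) : ℝ :=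
  (r p)⁻¹ ^ 2 * source a l r ω φ p
    - (r p)⁻¹ ^ 2 * (Du D r p * Dv D r p) - a / (2 * l ^ 2) * exp (ω p) ^ 2

namespace InteriorSol

variable {a l A B C E r₀ R : ℝ} {r ω φ : ℝ × ℝ → ℝ}

local notation "𝔇" => puncturedRect A B C E

lemma r_ne (h : InteriorSol a l A B C E r₀ R r ω φ) {p : ℝ × ℝ} (hp : p ∈ 𝔇) : r p ≠ 0 :=
  (h.r₀_pos.trans_le (h.le_r p hp)).ne'

lemma uniqueDiffOn (h : InteriorSol a l A B C E r₀ R r ω φ) : UniqueDiffOn ℝ 𝔇 :=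
  puncturedRect_uniqueDiffOn h.lt_u h.lt_v

lemma comm (h : InteriorSol a l A B C E r₀ R r ω φ) {f : ℝ × ℝ → ℝ} (hf : ContDiffOn ℝ 2 f 𝔇)
    {p : ℝ × ℝ} (hp : p ∈ 𝔇) : Du 𝔇 (Dv 𝔇 f) p = Dv 𝔇 (Du 𝔇 f) p :=
  Du_Dv_comm h.uniqueDiffOn (puncturedRect_subset_closure_interior h.lt_u h.lt_v) hf hp

lemma bd_r (h : InteriorSol a l A B C E r₀ R r ω φ) : Bd 𝔇 r :=
  ⟨R, fun p hp => by
    rw [abs_of_pos (h.r₀_pos.trans_le (h.le_r p hp))]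
    exact h.r_le p hp⟩

lemma bd_inv_r (h : InteriorSol a l A B C E r₀ R r ω φ) : Bd 𝔇 fun p => (r p)⁻¹ :=
  Bd.inv h.r₀_pos h.le_r

lemma contDiffOn_inv_r (h : InteriorSol a l A B C E r₀ R r ω φ) :
    ContDiffOn ℝ 3 (fun p => (r p)⁻¹) 𝔇 := h.contDiffOn_r.inv fun _ hp => h.r_ne hp

lemma contDiffOn_Du (h : InteriorSol a l A B C E r₀ R r ω φ) {f : ℝ × ℝ → ℝ}
    (hf : ContDiffOn ℝ 3 f 𝔇) : ContDiffOn ℝ 2 (Du 𝔇 f) 𝔇 :=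
  hf.Du_of_le h.uniqueDiffOn (by norm_num)

lemma contDiffOn_Dv (h : InteriorSol a l A B C E r₀ R r ω φ) {f : ℝ × ℝ → ℝ}
    (hf : ContDiffOn ℝ 3 f 𝔇) : ContDiffOn ℝ 2 (Dv 𝔇 f) 𝔇 :=
  hf.Dv_of_le h.uniqueDiffOn (by norm_num)

lemma contDiffOn_source (h : InteriorSol a l A B C E r₀ R r ω φ) :
    ContDiffOn ℝ 2 (source a l r ω φ) 𝔇 := by
  have h1 := h.contDiffOn_r.of_le (m := 2) (by norm_num)
  have h2 := h.contDiffOn_ω.of_le (m := 2) (by norm_num)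
  have h3 := h.contDiffOn_φ.of_le (m := 2) (by norm_num)
  unfold source
  fun_prop

lemma contDiffOn_potential (h : InteriorSol a l A B C E r₀ R r ω φ) :
    ContDiffOn ℝ 2 (potential a l 𝔇 r ω φ) 𝔇 := by
  have h1 := h.contDiffOn_r.of_le (m := 2) (by norm_num)
  have h2 := h.contDiffOn_ω.of_le (m := 2) (by norm_num)
  have h3 := h.contDiffOn_inv_r.of_le (m := 2) (by norm_num)
  have h4 := h.contDiffOn_source
  have h5 := h.contDiffOn_Du h.contDiffOn_r
  have h6 := h.contDiffOn_Dv h.contDiffOn_r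
  unfold potential
  fun_prop

lemma Dv_Du_r (h : InteriorSol a l A B C E r₀ R r ω φ) {p : ℝ × ℝ} (hp : p ∈ 𝔇) :
    Dv 𝔇 (Du 𝔇 r) p = (r p)⁻¹ * source a l r ω φ p - (r p)⁻¹ * (Du 𝔇 r p * Dv 𝔇 r p) := by
  have h1 := (h.sys p hp).e3
  simp only [jetWithin] at h1
  have h2 := h.r_ne hp
  have h3 := h.l_ne
  rw [h1, source]
  field_simp
  ring

lemma Dv_r_mul_Du (h : InteriorSol a l A B C E r₀ R r ω φ) {p : ℝ × ℝ} (hp : p ∈ 𝔇) :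
    Dv 𝔇 (fun q => r q * Du 𝔇 r q) p = source a l r ω φ p := by
  rw [Dv_mul h.uniqueDiffOn (h.contDiffOn_r.of_le (by norm_num))
    ((h.contDiffOn_Du h.contDiffOn_r).of_le (by norm_num)) hp, h.Dv_Du_r hp]
  have h2 := h.r_ne hp
  field_simp
  ring

lemma Du_r_mul_Dv (h : InteriorSol a l A B C E r₀ R r ω φ) {p : ℝ × ℝ} (hp : p ∈ 𝔇) :
    Du 𝔇 (fun q => r q * Dv 𝔇 r q) p = source a l r ω φ p := by
  rw [Du_mul h.uniqueDiffOn (h.contDiffOn_r.of_le (by norm_num))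
    ((h.contDiffOn_Dv h.contDiffOn_r).of_le (by norm_num)) hp,
    h.comm (h.contDiffOn_r.of_le (by norm_num)) hp, h.Dv_Du_r hp]
  have h2 := h.r_ne hp
  field_simp
  ring

lemma Dv_Du_sq (h : InteriorSol a l A B C E r₀ R r ω φ) {p : ℝ × ℝ} (hp : p ∈ 𝔇) :
    Dv 𝔇 (Du 𝔇 fun q => r q * r q) p = 2 * source a l r ω φ p := by
  have h1 : ContDiffOn ℝ 1 r 𝔇 := h.contDiffOn_r.of_le (by norm_num)
  have h2 : ContDiffOn ℝ 1 (Du 𝔇 r) 𝔇 := (h.contDiffOn_Du h.contDiffOn_r).of_le (by norm_num)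
  have : EqOn (Du 𝔇 fun q => r q * r q) (fun q => 2 * (r q * Du 𝔇 r q)) 𝔇 := fun q hq => by
    rw [Du_mul h.uniqueDiffOn h1 h1 hq]; ring
  rw [Dv_congr this hp, Dv_const_mul h.uniqueDiffOn (h1.mul h2) _ hp, h.Dv_r_mul_Du hp]

lemma Dv_Du_mul_φ (h : InteriorSol a l A B C E r₀ R r ω φ) {p : ℝ × ℝ} (hp : p ∈ 𝔇) :
    Dv 𝔇 (Du 𝔇 fun q => r q * φ q) p = potential a l 𝔇 r ω φ p * (r p * φ p) := by
  have hD := h.uniqueDiffOn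
  have h1 : ContDiffOn ℝ 1 r 𝔇 := h.contDiffOn_r.of_le (by norm_num)
  have h2 : ContDiffOn ℝ 1 (Du 𝔇 r) 𝔇 := (h.contDiffOn_Du h.contDiffOn_r).of_le (by norm_num)
  have h3 : ContDiffOn ℝ 1 φ 𝔇 := h.contDiffOn_φ.of_le (by norm_num)
  have h4 : ContDiffOn ℝ 1 (Du 𝔇 φ) 𝔇 := (h.contDiffOn_Du h.contDiffOn_φ).of_le (by norm_num)
  have : EqOn (Du 𝔇 fun q => r q * φ q) (fun q => Du 𝔇 r q * φ q + r q * Du 𝔇 φ q) 𝔇 :=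
    fun q hq => by rw [Du_mul hD h1 h3 hq]
  rw [Dv_congr this hp, Dv_add hD (h2.mul h3) (h1.mul h4) hp, Dv_mul hD h2 h3 hp,
    Dv_mul hD h1 h4 hp, h.Dv_Du_r hp]
  have h5 := (h.sys p hp).e5
  simp only [jetWithin] at h5
  have h6 : Dv 𝔇 (Du 𝔇 φ) p = -((Du 𝔇 r p / r p) * Dv 𝔇 φ p + (Dv 𝔇 r p / r p) * Du 𝔇 φ p
        + ((exp (ω p)) ^ 2 * a / (2 * l ^ 2)) * φ p) := by linarith
  rw [h6, potential]
  have h7 := h.r_ne hp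
  have h8 := h.l_ne
  field_simp
  ring

end InteriorSol

namespace InteriorSol

variable {a l A B C E r₀ R : ℝ} {r ω φ : ℝ × ℝ → ℝ}

local notation "𝔇" => puncturedRect A B C E

/-- The potential part of the source is integrable: no sign of the mass parameter is needed, since
the remaining terms of the source are under control. -/
lemma integrableOn_sq (h : InteriorSol a l A B C E r₀ R r ω φ) :
    IntegrableOn (fun p => 2 * π * a / l ^ 2 * (exp (ω p) ^ 2 * (r p * φ p) ^ 2)) 𝔇 := by
  have hr := h.contDiffOn_r.continuousOn
  have hω := h.contDiffOn_ω.continuousOn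
  have hφ := h.contDiffOn_φ.continuousOn
  have hS := h.contDiffOn_source.continuousOn
  set κ := 2 * π * a / l ^ 2 with hκ
  set G : ℝ × ℝ → ℝ := fun p => exp (ω p) ^ 2 * (1 / 4 + 3 / (4 * l ^ 2) * (r p) ^ 2) with hG
  have hGc : ContinuousOn G 𝔇 := by fun_prop
  have hFc : ContinuousOn (fun p => κ * (exp (ω p) ^ 2 * (r p * φ p) ^ 2)) 𝔇 := by fun_prop
  have hG0 : ∀ p, 0 ≤ G p := fun p => by positivity
  have hGi : IntegrableOn G 𝔇 := by
    have hb : Bd 𝔇 fun p => 1 / 4 + 3 / (4 * l ^ 2) * (r p) ^ 2 := by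
      simp only [pow_two (r _)]
      exact (Bd.const _).add ((h.bd_r.mul h.bd_r).const_mul _)
    have := IntegrableOn.bd_mul measurableSet_puncturedRect h.vol (by fun_prop) (by fun_prop) hb
    exact this.congr_fun (fun p _ => mul_comm _ _) measurableSet_puncturedRect
  refine integrableOn_of_bound_rect h.lt_u hFc (R ^ 2 + ∫ z in 𝔇, G z) fun u v hp => ?_
  have hsub := rect_subset_puncturedRect hp
  have hms : MeasurableSet (Icc A u ×ˢ Icc C v) := measurableSet_Icc.prod measurableSet_Icc
  have hm := mem_puncturedRect.1 hp
  have e1 : ∫ z in Icc A u ×ˢ Icc C v, ‖κ * (exp (ω z) ^ 2 * (r z * φ z) ^ 2)‖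
      = |∫ z in Icc A u ×ˢ Icc C v, κ * (exp (ω z) ^ 2 * (r z * φ z) ^ 2)| := by
    rw [integral_const_mul, abs_mul, abs_of_nonneg (integral_nonneg fun z => by positivity),
      ← integral_const_mul]
    refine integral_congr_ae (ae_of_all _ fun z => ?_)
    simp only [norm_mul, Real.norm_eq_abs, abs_pow, abs_exp, abs_mul]
    simp only [mul_pow, sq_abs]
  have e2 : ∫ z in Icc A u ×ˢ Icc C v, κ * (exp (ω z) ^ 2 * (r z * φ z) ^ 2)
      = (∫ z in Icc A u ×ˢ Icc C v, source a l r ω φ z) + ∫ z in Icc A u ×ˢ Icc C v, G z := by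
    rw [← integral_add (hS.integrableOn_rect hp) (hGc.integrableOn_rect hp)]
    refine integral_congr_ae (ae_of_all _ fun z => ?_)
    simp only [source, hG, hκ]
    ring
  have e3 : 2 * ∫ z in Icc A u ×ˢ Icc C v, source a l r ω φ z
      = r (u, v) * r (u, v) - r (A, v) * r (A, v) - r (u, C) * r (u, C) + r (A, C) * r (A, C) := by
    rw [← integral_const_mul, ← setIntegral_Dv_Du h.lt_u h.lt_v (f := fun q => r q * r q)
      ((h.contDiffOn_r.mul h.contDiffOn_r).of_le (by norm_num)) hp]
    exact setIntegral_congr_fun hms fun z hz => (h.Dv_Du_sq (hsub hz)).symm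
  have e4 : ∫ z in Icc A u ×ˢ Icc C v, G z ≤ ∫ z in 𝔇, G z :=
    setIntegral_mono_set hGi (ae_of_all _ hG0) hsub.eventuallyLE
  have e5 : 0 ≤ ∫ z in Icc A u ×ˢ Icc C v, G z := integral_nonneg hG0
  have hsq : ∀ p ∈ 𝔇, 0 ≤ r p * r p ∧ r p * r p ≤ R ^ 2 := fun p hp => by
    have h0 := (h.r₀_pos.trans_le (h.le_r p hp)).le
    have h1 := h.r_le p hp
    exact ⟨by positivity, by rw [pow_two]; exact mul_le_mul h1 h1 h0 (h0.trans h1)⟩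
  have s1 := hsq _ hp
  have s2 := hsq (A, v) (mem_puncturedRect_of_le hp le_rfl hm.1.1 hm.2.1.1 le_rfl)
  have s3 := hsq (u, C) (mem_puncturedRect_of_le hp hm.1.1 le_rfl le_rfl hm.2.1.1)
  have s4 := hsq (A, C) (mem_puncturedRect_of_le hp le_rfl hm.1.1 le_rfl hm.2.1.1)
  rw [e1, e2, abs_le]
  constructor <;> linarith [s1.1, s1.2, s2.1, s2.2, s3.1, s3.2, s4.1, s4.2]

lemma integrableOn_source (h : InteriorSol a l A B C E r₀ R r ω φ) :
    IntegrableOn (source a l r ω φ) 𝔇 := by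
  have hr := h.contDiffOn_r.continuousOn
  have hω := h.contDiffOn_ω.continuousOn
  have hb : Bd 𝔇 fun p => -(1 / 4) - 3 / (4 * l ^ 2) * (r p) ^ 2 := by
    simp only [pow_two (r _)]
    exact (Bd.const _).sub ((h.bd_r.mul h.bd_r).const_mul _)
  have h1 := IntegrableOn.bd_mul measurableSet_puncturedRect h.vol (by fun_prop) (by fun_prop) hb
  refine (h.integrableOn_sq.add h1).congr_fun (fun p _ => ?_) measurableSet_puncturedRect
  simp only [source, Pi.add_apply]
  ring

lemma integrableOn_Du_mul_Dv (h : InteriorSol a l A B C E r₀ R r ω φ) :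
    IntegrableOn (fun p => Du 𝔇 r p * Dv 𝔇 r p) 𝔇 := by
  have h1 : ContDiffOn ℝ 1 r 𝔇 := h.contDiffOn_r.of_le (by norm_num)
  have h2 : ContDiffOn ℝ 1 (Du 𝔇 r) 𝔇 := (h.contDiffOn_Du h.contDiffOn_r).of_le (by norm_num)
  have h3 : ContDiffOn ℝ 1 (Dv 𝔇 r) 𝔇 := (h.contDiffOn_Dv h.contDiffOn_r).of_le (by norm_num)
  have h4 := integrableOn_mul_of_deriv_le h.lt_u h.lt_v (h1.mul h2) (h1.mul h3)
    h.integrableOn_source.abs (fun p hp => by rw [h.Dv_r_mul_Du hp])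
    (fun p hp => by rw [h.Du_r_mul_Dv hp])
  have h5 := h.contDiffOn_inv_r.continuousOn
  refine (IntegrableOn.bd_mul measurableSet_puncturedRect h4
    ((h1.mul h2).mul (h1.mul h3)).continuousOn (h5.mul h5)
    (h.bd_inv_r.mul h.bd_inv_r)).congr_fun (fun p hp => ?_) measurableSet_puncturedRect
  have := h.r_ne hp
  simp only [Pi.mul_apply]
  field_simp

lemma integrableOn_potential (h : InteriorSol a l A B C E r₀ R r ω φ) :
    IntegrableOn (potential a l 𝔇 r ω φ) 𝔇 := by
  have h2 := (h.contDiffOn_Du h.contDiffOn_r).continuousOn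
  have h3 := (h.contDiffOn_Dv h.contDiffOn_r).continuousOn
  have h5 := h.contDiffOn_inv_r.continuousOn
  have hb := h.bd_inv_r.mul h.bd_inv_r
  have e1 := IntegrableOn.bd_mul measurableSet_puncturedRect h.integrableOn_source
    h.contDiffOn_source.continuousOn (h5.mul h5) hb
  have e2 := IntegrableOn.bd_mul measurableSet_puncturedRect h.integrableOn_Du_mul_Dv
    (h2.mul h3) (h5.mul h5) hb
  refine ((e1.sub e2).sub (h.vol.const_mul (a / (2 * l ^ 2)))).congr_fun (fun p hp => ?_)
    measurableSet_puncturedRect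
  simp only [potential, Pi.sub_apply, Pi.mul_apply, pow_two (r p)⁻¹]

lemma bd_mul_φ (h : InteriorSol a l A B C E r₀ R r ω φ) : Bd 𝔇 fun p => r p * φ p :=
  Bd_of_mixed_eq_mul h.lt_u h.lt_v ((h.contDiffOn_r.mul h.contDiffOn_φ).of_le (by norm_num))
    h.contDiffOn_potential.continuousOn h.integrableOn_potential fun _ hp => h.Dv_Du_mul_φ hp

lemma bd_φ (h : InteriorSol a l A B C E r₀ R r ω φ) : Bd 𝔇 φ :=
  (h.bd_inv_r.mul h.bd_mul_φ).congr fun p hp => by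
    have := h.r_ne hp
    field_simp

lemma bd_ω (h : InteriorSol a l A B C E r₀ R r ω φ) : Bd 𝔇 ω := by
  have hD := h.uniqueDiffOn
  have hms : MeasurableSet 𝔇 := measurableSet_puncturedRect
  have r1 : ContDiffOn ℝ 1 r 𝔇 := h.contDiffOn_r.of_le (by norm_num)
  have r2 : ContDiffOn ℝ 1 (Du 𝔇 r) 𝔇 := (h.contDiffOn_Du h.contDiffOn_r).of_le (by norm_num)
  have r3 : ContDiffOn ℝ 1 (Dv 𝔇 r) 𝔇 := (h.contDiffOn_Dv h.contDiffOn_r).of_le (by norm_num)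
  have hψ : ContDiffOn ℝ 3 (fun p => r p * φ p) 𝔇 := h.contDiffOn_r.mul h.contDiffOn_φ
  set ψ : ℝ × ℝ → ℝ := fun p => r p * φ p with hψdef
  have p2 : ContDiffOn ℝ 1 (Du 𝔇 ψ) 𝔇 := (h.contDiffOn_Du hψ).of_le (by norm_num)
  have p3 : ContDiffOn ℝ 1 (Dv 𝔇 ψ) 𝔇 := (h.contDiffOn_Dv hψ).of_le (by norm_num)
  have hφ : ContDiffOn ℝ 1 φ 𝔇 := h.contDiffOn_φ.of_le (by norm_num)
  have hψi : IntegrableOn (fun p => ψ p * potential a l 𝔇 r ω φ p) 𝔇 :=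
    IntegrableOn.bd_mul hms h.integrableOn_potential h.contDiffOn_potential.continuousOn
      hψ.continuousOn h.bd_mul_φ
  set T : ℝ × ℝ → ℝ := fun p => |source a l r ω φ p| + |ψ p * potential a l 𝔇 r ω φ p| with hT
  have hTi : IntegrableOn T 𝔇 := h.integrableOn_source.abs.add hψi.abs
  have t1 : ∀ p ∈ 𝔇, |Dv 𝔇 (fun q => r q * Du 𝔇 r q) p| ≤ T p := fun p hp => by
    rw [h.Dv_r_mul_Du hp]; exact le_add_of_nonneg_right (abs_nonneg _)
  have t2 : ∀ p ∈ 𝔇, |Du 𝔇 (fun q => r q * Dv 𝔇 r q) p| ≤ T p := fun p hp => by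
    rw [h.Du_r_mul_Dv hp]; exact le_add_of_nonneg_right (abs_nonneg _)
  have t3 : ∀ p ∈ 𝔇, |Dv 𝔇 (Du 𝔇 ψ) p| ≤ T p := fun p hp => by
    rw [h.Dv_Du_mul_φ hp, mul_comm]; exact le_add_of_nonneg_left (abs_nonneg _)
  have t4 : ∀ p ∈ 𝔇, |Du 𝔇 (Dv 𝔇 ψ) p| ≤ T p := fun p hp => by
    rw [h.comm (hψ.of_le (by norm_num)) hp]; exact t3 p hp
  have i1 := integrableOn_mul_of_deriv_le h.lt_u h.lt_v p2 p3 hTi t3 t4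
  have i2 := integrableOn_mul_of_deriv_le h.lt_u h.lt_v p2 (r1.mul r3) hTi t3 t2
  have i3 := integrableOn_mul_of_deriv_le h.lt_u h.lt_v (r1.mul r2) p3 hTi t1 t4
  have i4 := h.integrableOn_Du_mul_Dv
  have c0 := h.contDiffOn_inv_r.continuousOn
  have c1 := hφ.continuousOn
  have ci := r1.continuousOn
  have cu := r2.continuousOn
  have cv := r3.continuousOn
  have cpu := p2.continuousOn
  have cpv := p3.continuousOn
  have b2 := h.bd_inv_r.mul h.bd_inv_r
  have hi : IntegrableOn (Dv 𝔇 (Du 𝔇 ω)) 𝔇 := by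
    have j0 := IntegrableOn.bd_mul hms h.vol (h.contDiffOn_ω.continuousOn.rexp.pow 2)
      (c0.mul c0) b2
    have j1 := IntegrableOn.bd_mul hms i1 (by fun_prop) (c0.mul c0) b2
    have j2 := IntegrableOn.bd_mul hms i2 (by fun_prop) ((c0.mul c0).mul (c0.mul c1))
      (b2.mul (h.bd_inv_r.mul h.bd_φ))
    have j3 := IntegrableOn.bd_mul hms i3 (by fun_prop) ((c0.mul c0).mul (c0.mul c1))
      (b2.mul (h.bd_inv_r.mul h.bd_φ))
    have j4 := IntegrableOn.bd_mul hms i4 (by fun_prop) ((c0.mul c0).mul (c1.mul c1))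
      (b2.mul (h.bd_φ.mul h.bd_φ))
    have j5 := IntegrableOn.bd_mul hms i4 (by fun_prop) (c0.mul c0) b2
    refine IntegrableOn.congr_fun (((j0.const_mul (1 / 4)).add j5).sub
      ((((j1.sub j2).sub j3).add j4).const_mul (4 * π))) (fun p hp => ?_) hms
    have e4 := (h.sys p hp).e4
    simp only [jetWithin] at e4
    have hu : Du 𝔇 ψ p = Du 𝔇 r p * φ p + r p * Du 𝔇 φ p := Du_mul hD r1 hφ hp
    have hv : Dv 𝔇 ψ p = Dv 𝔇 r p * φ p + r p * Dv 𝔇 φ p := Dv_mul hD r1 hφ hp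
    have hne := h.r_ne hp
    simp only [Pi.add_apply, Pi.sub_apply, Pi.mul_apply]
    rw [e4, hu, hv]
    field_simp
    ring
  exact Bd_of_integrableOn_mixed h.lt_u h.lt_v (h.contDiffOn_ω.of_le (by norm_num)) hi

end InteriorSol

/-- `C¹` functions on `D` which are bounded together with their first derivatives. -/
structure C1B (D : Set (ℝ × ℝ)) (f : ℝ × ℝ → ℝ) : Prop where
  contDiffOn : ContDiffOn ℝ 1 f D
  bd : Bd D f
  bd_u : Bd D (Du D f)
  bd_v : Bd D (Dv D f)

namespace C1B

variable {D : Set (ℝ × ℝ)} {f g : ℝ × ℝ → ℝ}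

lemma congr (hf : C1B D f) (h : ∀ p ∈ D, g p = f p) : C1B D g :=
  ⟨hf.contDiffOn.congr h, hf.bd.congr h, hf.bd_u.congr fun _ hp => Du_congr h hp,
    hf.bd_v.congr fun _ hp => Dv_congr h hp⟩

lemma const (c : ℝ) : C1B D fun _ => c :=
  ⟨contDiffOn_const, Bd.const c, (Bd.const 0).congr fun _ _ => Du_const c,
    (Bd.const 0).congr fun _ _ => Dv_const c⟩

lemma add (hD : UniqueDiffOn ℝ D) (hf : C1B D f) (hg : C1B D g) : C1B D fun p => f p + g p :=
  ⟨hf.contDiffOn.add hg.contDiffOn, hf.bd.add hg.bd,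
    (hf.bd_u.add hg.bd_u).congr fun _ hp => Du_add hD hf.contDiffOn hg.contDiffOn hp,
    (hf.bd_v.add hg.bd_v).congr fun _ hp => Dv_add hD hf.contDiffOn hg.contDiffOn hp⟩

lemma mul (hD : UniqueDiffOn ℝ D) (hf : C1B D f) (hg : C1B D g) : C1B D fun p => f p * g p :=
  ⟨hf.contDiffOn.mul hg.contDiffOn, hf.bd.mul hg.bd,
    ((hf.bd_u.mul hg.bd).add (hf.bd.mul hg.bd_u)).congr
      fun _ hp => Du_mul hD hf.contDiffOn hg.contDiffOn hp,
    ((hf.bd_v.mul hg.bd).add (hf.bd.mul hg.bd_v)).congr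
      fun _ hp => Dv_mul hD hf.contDiffOn hg.contDiffOn hp⟩

lemma const_mul (hD : UniqueDiffOn ℝ D) (c : ℝ) (hf : C1B D f) : C1B D fun p => c * f p :=
  (const c).mul hD hf

lemma sub (hD : UniqueDiffOn ℝ D) (hf : C1B D f) (hg : C1B D g) : C1B D fun p => f p - g p :=
  (hf.add hD (hg.const_mul hD (-1))).congr fun _ _ => by ring

lemma exp (hD : UniqueDiffOn ℝ D) (hf : C1B D f) : C1B D fun p => exp (f p) :=
  ⟨hf.contDiffOn.exp, hf.bd.exp,
    (hf.bd.exp.mul hf.bd_u).congr fun _ hp => Du_comp hD hf.contDiffOn hp (hasDerivAt_exp _),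
    (hf.bd.exp.mul hf.bd_v).congr fun _ hp => Dv_comp hD hf.contDiffOn hp (hasDerivAt_exp _)⟩

lemma inv (hD : UniqueDiffOn ℝ D) (hf : C1B D f) {c : ℝ} (hc : 0 < c) (h : ∀ p ∈ D, c ≤ f p) :
    C1B D fun p => (f p)⁻¹ := by
  have hne : ∀ p ∈ D, f p ≠ 0 := fun p hp => (hc.trans_le (h p hp)).ne'
  have hb := Bd.inv hc h
  refine ⟨hf.contDiffOn.inv hne, hb,
    (((hb.mul hb).const_mul (-1)).mul hf.bd_u).congr fun p hp => ?_,
    (((hb.mul hb).const_mul (-1)).mul hf.bd_v).congr fun p hp => ?_⟩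
  · rw [Du_comp hD hf.contDiffOn hp (hasDerivAt_inv (hne p hp))]
    field_simp
  · rw [Dv_comp hD hf.contDiffOn hp (hasDerivAt_inv (hne p hp))]
    field_simp

end C1B

namespace InteriorSol

variable {a l A B C E r₀ R : ℝ} {r ω φ : ℝ × ℝ → ℝ}

local notation "𝔇" => puncturedRect A B C E

/-- Regularity of the mixed derivative controls all second derivatives. -/
lemma C1B_of_mixed (h : InteriorSol a l A B C E r₀ R r ω φ) {f : ℝ × ℝ → ℝ}
    (hf : ContDiffOn ℝ 3 f 𝔇) (hfb : C1B 𝔇 (Dv 𝔇 (Du 𝔇 f))) :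
    C1B 𝔇 (Du 𝔇 f) ∧ C1B 𝔇 (Dv 𝔇 f) := by
  have hD := h.uniqueDiffOn
  have hu := h.contDiffOn_Du hf
  have hv := h.contDiffOn_Dv hf
  have hvu : Bd 𝔇 (Du 𝔇 (Dv 𝔇 f)) :=
    hfb.bd.congr fun p hp => h.comm (hf.of_le (by norm_num)) hp
  refine ⟨⟨hu.of_le (by norm_num), ?_, ?_, hfb.bd⟩, ⟨hv.of_le (by norm_num), ?_, hvu, ?_⟩⟩
  · exact Bd_of_Bd_Dv h.lt_u h.lt_v (hu.of_le (by norm_num)) hfb.bd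
  · refine Bd_of_Bd_Dv h.lt_u h.lt_v (hu.Du_of_le hD (by norm_num)) (hfb.bd_u.congr fun p hp => ?_)
    exact (h.comm hu hp).symm
  · exact Bd_of_Bd_Du h.lt_u h.lt_v (hv.of_le (by norm_num)) hvu
  · refine Bd_of_Bd_Du h.lt_u h.lt_v (hv.Dv_of_le hD (by norm_num)) (hfb.bd_v.congr fun p hp => ?_)
    rw [h.comm hv hp]
    exact Dv_congr (fun q hq => h.comm (hf.of_le (by norm_num)) hq) hp

lemma bd_source (h : InteriorSol a l A B C E r₀ R r ω φ) : Bd 𝔇 (source a l r ω φ) := by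
  have hψ := h.bd_mul_φ
  refine ((h.bd_ω.exp.mul h.bd_ω.exp).mul (((Bd.const (-(1 / 4))).add
    ((hψ.mul hψ).const_mul (2 * π * a / l ^ 2))).sub
    ((h.bd_r.mul h.bd_r).const_mul (3 / (4 * l ^ 2))))).congr fun p _ => ?_
  simp only [source]
  ring

lemma bd_Du_r (h : InteriorSol a l A B C E r₀ R r ω φ) : Bd 𝔇 (Du 𝔇 r) := by
  have h1 : Bd 𝔇 fun p => r p * Du 𝔇 r p :=
    Bd_of_Bd_Dv h.lt_u h.lt_v
      ((h.contDiffOn_r.of_le (by norm_num)).mul ((h.contDiffOn_Du h.contDiffOn_r).of_le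
        (by norm_num))) (h.bd_source.congr fun p hp => h.Dv_r_mul_Du hp)
  refine (h.bd_inv_r.mul h1).congr fun p hp => ?_
  have := h.r_ne hp
  field_simp

lemma bd_Dv_r (h : InteriorSol a l A B C E r₀ R r ω φ) : Bd 𝔇 (Dv 𝔇 r) := by
  have h1 : Bd 𝔇 fun p => r p * Dv 𝔇 r p :=
    Bd_of_Bd_Du h.lt_u h.lt_v
      ((h.contDiffOn_r.of_le (by norm_num)).mul ((h.contDiffOn_Dv h.contDiffOn_r).of_le
        (by norm_num))) (h.bd_source.congr fun p hp => h.Du_r_mul_Dv hp)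
  refine (h.bd_inv_r.mul h1).congr fun p hp => ?_
  have := h.r_ne hp
  field_simp

lemma bd_potential (h : InteriorSol a l A B C E r₀ R r ω φ) : Bd 𝔇 (potential a l 𝔇 r ω φ) := by
  have hi := h.bd_inv_r.mul h.bd_inv_r
  refine (((hi.mul h.bd_source).sub (hi.mul (h.bd_Du_r.mul h.bd_Dv_r))).sub
    ((h.bd_ω.exp.mul h.bd_ω.exp).const_mul (a / (2 * l ^ 2)))).congr fun p _ => ?_
  simp only [potential]
  ring

lemma C1B_r (h : InteriorSol a l A B C E r₀ R r ω φ) : C1B 𝔇 r :=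
  ⟨h.contDiffOn_r.of_le (by norm_num), h.bd_r, h.bd_Du_r, h.bd_Dv_r⟩

lemma C1B_inv_r (h : InteriorSol a l A B C E r₀ R r ω φ) : C1B 𝔇 fun p => (r p)⁻¹ :=
  h.C1B_r.inv h.uniqueDiffOn h.r₀_pos h.le_r

lemma C1B_mul_φ (h : InteriorSol a l A B C E r₀ R r ω φ) : C1B 𝔇 fun p => r p * φ p := by
  have hψ : ContDiffOn ℝ 3 (fun p => r p * φ p) 𝔇 := h.contDiffOn_r.mul h.contDiffOn_φ
  have hb : Bd 𝔇 (Dv 𝔇 (Du 𝔇 fun p => r p * φ p)) :=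
    (h.bd_potential.mul h.bd_mul_φ).congr fun p hp => h.Dv_Du_mul_φ hp
  exact ⟨hψ.of_le (by norm_num), h.bd_mul_φ,
    Bd_of_Bd_Dv h.lt_u h.lt_v ((h.contDiffOn_Du hψ).of_le (by norm_num)) hb,
    Bd_of_Bd_Du h.lt_u h.lt_v ((h.contDiffOn_Dv hψ).of_le (by norm_num))
      (hb.congr fun p hp => h.comm (hψ.of_le (by norm_num)) hp)⟩

lemma C1B_φ (h : InteriorSol a l A B C E r₀ R r ω φ) : C1B 𝔇 φ :=
  (h.C1B_inv_r.mul h.uniqueDiffOn h.C1B_mul_φ).congr fun p hp => by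
    have := h.r_ne hp
    field_simp

lemma Dv_Du_ω (h : InteriorSol a l A B C E r₀ R r ω φ) {p : ℝ × ℝ} (hp : p ∈ 𝔇) :
    Dv 𝔇 (Du 𝔇 ω) p = (r p)⁻¹ * (r p)⁻¹ * (1 / 4 * (exp (ω p) * exp (ω p))
      + Du 𝔇 r p * Dv 𝔇 r p) - 4 * π * (Du 𝔇 φ p * Dv 𝔇 φ p) := by
  have e4 := (h.sys p hp).e4
  simp only [jetWithin] at e4
  have hne := h.r_ne hp
  rw [e4]
  field_simp

lemma C1B_ω (h : InteriorSol a l A B C E r₀ R r ω φ) : C1B 𝔇 ω := by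
  have hb : Bd 𝔇 (Dv 𝔇 (Du 𝔇 ω)) :=
    (((h.bd_inv_r.mul h.bd_inv_r).mul (((h.bd_ω.exp.mul h.bd_ω.exp).const_mul (1 / 4)).add
      (h.bd_Du_r.mul h.bd_Dv_r))).sub ((h.C1B_φ.bd_u.mul h.C1B_φ.bd_v).const_mul (4 * π))).congr
      fun p hp => h.Dv_Du_ω hp
  have hω := h.contDiffOn_ω
  exact ⟨hω.of_le (by norm_num), h.bd_ω,
    Bd_of_Bd_Dv h.lt_u h.lt_v ((h.contDiffOn_Du hω).of_le (by norm_num)) hb,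
    Bd_of_Bd_Du h.lt_u h.lt_v ((h.contDiffOn_Dv hω).of_le (by norm_num))
      (hb.congr fun p hp => h.comm (hω.of_le (by norm_num)) hp)⟩

lemma bd_Dv_Du_r (h : InteriorSol a l A B C E r₀ R r ω φ) : Bd 𝔇 (Dv 𝔇 (Du 𝔇 r)) :=
  ((h.bd_inv_r.mul h.bd_source).sub (h.bd_inv_r.mul (h.bd_Du_r.mul h.bd_Dv_r))).congr
    fun _ hp => h.Dv_Du_r hp

lemma C1B_Du_r (h : InteriorSol a l A B C E r₀ R r ω φ) : C1B 𝔇 (Du 𝔇 r) := by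
  refine ⟨(h.contDiffOn_Du h.contDiffOn_r).of_le (by norm_num), h.bd_Du_r, ?_, h.bd_Dv_Du_r⟩
  refine (((h.bd_Du_r.mul h.C1B_ω.bd_u).const_mul 2).sub
    ((h.bd_r.mul (h.C1B_φ.bd_u.mul h.C1B_φ.bd_u)).const_mul (4 * π))).congr fun p hp => ?_
  have e := (h.sys p hp).e1
  simp only [jetWithin] at e
  rw [e]
  ring

lemma C1B_Dv_r (h : InteriorSol a l A B C E r₀ R r ω φ) : C1B 𝔇 (Dv 𝔇 r) := by
  refine ⟨(h.contDiffOn_Dv h.contDiffOn_r).of_le (by norm_num), h.bd_Dv_r,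
    h.bd_Dv_Du_r.congr fun p hp => h.comm (h.contDiffOn_r.of_le (by norm_num)) hp, ?_⟩
  refine (((h.bd_Dv_r.mul h.C1B_ω.bd_v).const_mul 2).sub
    ((h.bd_r.mul (h.C1B_φ.bd_v.mul h.C1B_φ.bd_v)).const_mul (4 * π))).congr fun p hp => ?_
  have e := (h.sys p hp).e2
  simp only [jetWithin] at e
  rw [e]
  ring

lemma C1B_source (h : InteriorSol a l A B C E r₀ R r ω φ) : C1B 𝔇 (source a l r ω φ) := by
  have hD := h.uniqueDiffOn
  have hψ := h.C1B_mul_φ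
  have hw := h.C1B_ω.exp hD
  refine ((hw.mul hD hw).mul hD (((C1B.const (-(1 / 4))).add hD
    ((hψ.mul hD hψ).const_mul hD (2 * π * a / l ^ 2))).sub hD
    ((h.C1B_r.mul hD h.C1B_r).const_mul hD (3 / (4 * l ^ 2))))).congr fun p _ => ?_
  simp only [source]
  ring

lemma C1B_Dv_Du_r (h : InteriorSol a l A B C E r₀ R r ω φ) : C1B 𝔇 (Dv 𝔇 (Du 𝔇 r)) := by
  have hD := h.uniqueDiffOn
  exact ((h.C1B_inv_r.mul hD h.C1B_source).sub hD
    (h.C1B_inv_r.mul hD (h.C1B_Du_r.mul hD h.C1B_Dv_r))).congr fun _ hp => h.Dv_Du_r hp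

lemma C1B_potential (h : InteriorSol a l A B C E r₀ R r ω φ) :
    C1B 𝔇 (potential a l 𝔇 r ω φ) := by
  have hD := h.uniqueDiffOn
  have hi := h.C1B_inv_r.mul hD h.C1B_inv_r
  have hw := h.C1B_ω.exp hD
  refine (((hi.mul hD h.C1B_source).sub hD (hi.mul hD (h.C1B_Du_r.mul hD h.C1B_Dv_r))).sub hD
    ((hw.mul hD hw).const_mul hD (a / (2 * l ^ 2)))).congr fun p _ => ?_
  simp only [potential]
  ring

lemma C1B_deriv_φ (h : InteriorSol a l A B C E r₀ R r ω φ) :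
    C1B 𝔇 (Du 𝔇 φ) ∧ C1B 𝔇 (Dv 𝔇 φ) := by
  have hD := h.uniqueDiffOn
  have hψ : ContDiffOn ℝ 3 (fun p => r p * φ p) 𝔇 := h.contDiffOn_r.mul h.contDiffOn_φ
  obtain ⟨hu, hv⟩ := h.C1B_of_mixed hψ
    ((h.C1B_potential.mul hD h.C1B_mul_φ).congr fun p hp => h.Dv_Du_mul_φ hp)
  constructor
  · refine (h.C1B_inv_r.mul hD (hu.sub hD (h.C1B_Du_r.mul hD h.C1B_φ))).congr fun p hp => ?_
    rw [Du_mul hD h.C1B_r.contDiffOn h.C1B_φ.contDiffOn hp]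
    have := h.r_ne hp
    field_simp
    ring
  · refine (h.C1B_inv_r.mul hD (hv.sub hD (h.C1B_Dv_r.mul hD h.C1B_φ))).congr fun p hp => ?_
    rw [Dv_mul hD h.C1B_r.contDiffOn h.C1B_φ.contDiffOn hp]
    have := h.r_ne hp
    field_simp
    ring

lemma C1B_Dv_Du_ω (h : InteriorSol a l A B C E r₀ R r ω φ) : C1B 𝔇 (Dv 𝔇 (Du 𝔇 ω)) := by
  have hD := h.uniqueDiffOn
  have hw := h.C1B_ω.exp hD
  obtain ⟨hu, hv⟩ := h.C1B_deriv_φ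
  exact (((h.C1B_inv_r.mul hD h.C1B_inv_r).mul hD (((hw.mul hD hw).const_mul hD (1 / 4)).add hD
    (h.C1B_Du_r.mul hD h.C1B_Dv_r))).sub hD ((hu.mul hD hv).const_mul hD (4 * π))).congr
    fun p hp => h.Dv_Du_ω hp

lemma C1B_Dv_Du_φ (h : InteriorSol a l A B C E r₀ R r ω φ) : C1B 𝔇 (Dv 𝔇 (Du 𝔇 φ)) := by
  have hD := h.uniqueDiffOn
  have hw := h.C1B_ω.exp hD
  obtain ⟨hu, hv⟩ := h.C1B_deriv_φ
  refine (((h.C1B_inv_r.mul hD ((h.C1B_Du_r.mul hD hv).add hD (h.C1B_Dv_r.mul hD hu))).add hD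
    (((hw.mul hD hw).mul hD h.C1B_φ).const_mul hD (a / (2 * l ^ 2)))).const_mul hD (-1)).congr
    fun p hp => ?_
  have e := (h.sys p hp).e5
  simp only [jetWithin] at e
  have e' : Dv 𝔇 (Du 𝔇 φ) p = -((Du 𝔇 r p / r p) * Dv 𝔇 φ p + (Dv 𝔇 r p / r p) * Du 𝔇 φ p
        + ((exp (ω p)) ^ 2 * a / (2 * l ^ 2)) * φ p) := by linarith
  rw [e']
  have := h.r_ne hp
  field_simp

end InteriorSol

section Reflection

/-- Coefficients of the derivative of the reflection operator with coefficients `c`. -/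
def reflCoef (c : ℕ → ℝ) (i : ℕ) : ℝ := -(i : ℝ) * c i

/-- The interval projection of `x`, followed by `i` times the reflected displacement. -/
def reflPt (A B : ℝ) (i : ℕ) (x : ℝ) : ℝ :=
  max A (min x B) - i * (x - max A (min x B))

/-- Extension of a function on `[A,B]` by a linear combination of reflections. -/
def reflExt (A B : ℝ) (c : ℕ → ℝ) (f : ℝ → ℝ) (x : ℝ) : ℝ :=
  ∑ i ∈ Finset.range 3, c i * f (reflPt A B i x)

/-- The open interval on which the reflections are defined. -/
def reflDom (A B : ℝ) : Set ℝ := Ioo (A - (B - A) / 2) (B + (B - A) / 2)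

variable {A B : ℝ} {f f' : ℝ → ℝ} {c : ℕ → ℝ} {x : ℝ} {i : ℕ}

lemma reflPt_of_mem (hx : x ∈ Icc A B) : reflPt A B i x = x := by
  simp [reflPt, min_eq_left hx.2, max_eq_right hx.1]

lemma reflPt_of_ge (hAB : A < B) (hx : B ≤ x) : reflPt A B i x = B - i * (x - B) := by
  simp [reflPt, min_eq_right hx, max_eq_right hAB.le]

lemma reflPt_of_le (hAB : A < B) (hx : x ≤ A) : reflPt A B i x = A - i * (x - A) := by
  simp [reflPt, min_eq_left (hx.trans hAB.le), max_eq_left hx]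

lemma continuous_reflPt : Continuous (reflPt A B i) := by
  unfold reflPt; fun_prop

lemma reflPt_mem (hAB : A < B) (hx : x ∈ reflDom A B) (hi : i ∈ Finset.range 3) :
    reflPt A B i x ∈ Icc A B := by
  have hi2 : (i : ℝ) ≤ 2 := by
    have := Finset.mem_range.1 hi
    exact_mod_cast (by omega : i ≤ 2)
  have hi0 : (0 : ℝ) ≤ i := i.cast_nonneg
  obtain ⟨h1, h2⟩ := hx
  rcases le_total x A with h | h
  · rw [reflPt_of_le hAB h]
    constructor <;> nlinarith
  rcases le_total x B with h' | h'
  · rw [reflPt_of_mem ⟨h, h'⟩]; exact ⟨h, h'⟩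
  · rw [reflPt_of_ge hAB h']
    constructor <;> nlinarith

lemma reflExt_of_mem (hc : ∑ i ∈ Finset.range 3, c i = 1) (hx : x ∈ Icc A B) :
    reflExt A B c f x = f x := by
  simp only [reflExt, reflPt_of_mem hx]
  rw [← Finset.sum_mul, hc, one_mul]

/-- The reflection of an affine branch is differentiable up to the end point. -/
lemma hasDerivWithinAt_sum_reflect {T : Set ℝ} {P : ℝ}
    (hT : ∀ y ∈ T, ∀ i ∈ Finset.range 3, P - i * (y - P) ∈ Icc A B)
    (hf : ∀ y ∈ Icc A B, HasDerivWithinAt f (f' y) (Icc A B) y) (hx : x ∈ T) :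
    HasDerivWithinAt (fun y => ∑ i ∈ Finset.range 3, c i * f (P - i * (y - P)))
      (∑ i ∈ Finset.range 3, reflCoef c i * f' (P - i * (x - P))) T x := by
  refine HasDerivWithinAt.fun_sum fun i hi => ?_
  have h1 : HasDerivWithinAt (fun y : ℝ => P - i * (y - P)) (-(i : ℝ)) T x := by
    simpa using (((hasDerivWithinAt_id x T).sub_const P).const_mul (i : ℝ)).const_sub P
  have h2 := ((hf _ (hT x hx i hi)).comp x h1 fun y hy => hT y hy i hi).const_mul (c i)
  refine h2.congr_deriv ?_
  simp only [reflCoef]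
  ring

lemma hasDerivAt_reflExt (hAB : A < B) (hc : ∑ i ∈ Finset.range 3, c i = 1)
    (hc' : ∑ i ∈ Finset.range 3, reflCoef c i = 1)
    (hf : ∀ y ∈ Icc A B, HasDerivWithinAt f (f' y) (Icc A B) y) (hx : x ∈ reflDom A B) :
    HasDerivAt (reflExt A B c f) (reflExt A B (reflCoef c) f' x) x := by
  have key : ∀ T : Set ℝ, IsClosed T → (x ∈ T →
      HasDerivWithinAt (reflExt A B c f) (reflExt A B (reflCoef c) f' x) T x) →
      HasDerivWithinAt (reflExt A B c f) (reflExt A B (reflCoef c) f' x) T x := by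
    intro T hT h
    by_cases hxT : x ∈ T
    · exact h hxT
    · exact HasFDerivWithinAt.of_notMem_closure (by rwa [hT.closure_eq])
  have h1 := key (Icc A B) isClosed_Icc fun h => by
    rw [reflExt_of_mem hc' h]
    exact (hf x h).congr (fun y hy => reflExt_of_mem hc hy) (reflExt_of_mem hc h)
  have h2 := key (Icc B (B + (B - A) / 2)) isClosed_Icc fun h => by
    have hE : ∀ (d : ℕ → ℝ) (g : ℝ → ℝ), ∀ y ∈ Icc B (B + (B - A) / 2),
        reflExt A B d g y = ∑ i ∈ Finset.range 3, d i * g (B - i * (y - B)) := fun d g y hy => by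
      simp only [reflExt, reflPt_of_ge hAB hy.1]
    rw [hE _ _ x h]
    refine HasDerivWithinAt.congr (hasDerivWithinAt_sum_reflect (fun y hy i hi => ?_) hf h)
      (hE c f) (hE c f x h)
    have hi2 : (i : ℝ) ≤ 2 := by
      have := Finset.mem_range.1 hi
      exact_mod_cast (by omega : i ≤ 2)
    have hi0 : (0 : ℝ) ≤ i := i.cast_nonneg
    constructor <;> nlinarith [hy.1, hy.2]
  have h3 := key (Icc (A - (B - A) / 2) A) isClosed_Icc fun h => by
    have hE : ∀ (d : ℕ → ℝ) (g : ℝ → ℝ), ∀ y ∈ Icc (A - (B - A) / 2) A,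
        reflExt A B d g y = ∑ i ∈ Finset.range 3, d i * g (A - i * (y - A)) := fun d g y hy => by
      simp only [reflExt, reflPt_of_le hAB hy.2]
    rw [hE _ _ x h]
    refine HasDerivWithinAt.congr (hasDerivWithinAt_sum_reflect (fun y hy i hi => ?_) hf h)
      (hE c f) (hE c f x h)
    have hi2 : (i : ℝ) ≤ 2 := by
      have := Finset.mem_range.1 hi
      exact_mod_cast (by omega : i ≤ 2)
    have hi0 : (0 : ℝ) ≤ i := i.cast_nonneg
    constructor <;> nlinarith [hy.1, hy.2]
  refine ((h3.union h1).union h2).hasDerivAt ?_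
  refine mem_of_superset (Icc_mem_nhds hx.1 hx.2) ?_
  rw [Icc_union_Icc_eq_Icc (by linarith) hAB.le, Icc_union_Icc_eq_Icc (by linarith) (by linarith)]

/-- A function which is continuous on `[A,B]` and has a derivative in the interior that extends
continuously is differentiable up to the boundary. -/
lemma hasDerivWithinAt_Icc_of_continuousOn (hf : ContinuousOn f (Icc A B))
    (hf' : ContinuousOn f' (Icc A B)) (hd : ∀ y ∈ Ioo A B, HasDerivAt f (f' y) y)
    (hx : x ∈ Icc A B) : HasDerivWithinAt f (f' x) (Icc A B) x := by
  have hAB : A ≤ B := hx.1.trans hx.2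
  have hg : Continuous (IccExtend hAB ((Icc A B).domRestrict f')) :=
    (continuousOn_iff_continuous_domRestrict.1 hf').Icc_extend'
  set g := IccExtend hAB ((Icc A B).domRestrict f') with hgdef
  have hgf : ∀ y ∈ Icc A B, g y = f' y := fun y hy => by
    rw [hgdef, IccExtend_of_mem hAB _ hy]; rfl
  have hF : ∀ y ∈ Icc A B, f y = f A + ∫ t in A..y, g t := fun y hy => by
    have := intervalIntegral.integral_eq_sub_of_hasDerivAt_of_le hy.1
      (hf.mono (Icc_subset_Icc_right hy.2))
      (fun t ht => (by
        rw [hgf t ⟨ht.1.le, ht.2.le.trans hy.2⟩]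
        exact hd t ⟨ht.1, ht.2.trans_le hy.2⟩ : HasDerivAt f (g t) t))
      (hg.intervalIntegrable _ _)
    rw [this]; ring
  have h := (intervalIntegral.integral_hasDerivAt_right (hg.intervalIntegrable A x)
    (hg.stronglyMeasurableAtFilter _ _) hg.continuousAt).const_add (f A)
  rw [hgf x hx] at h
  exact h.hasDerivWithinAt.congr hF (hF x hx)

end Reflection

section Reflection2

variable {A B C E : ℝ}

/-- Extension by reflections in both variables. -/
def reflExt₂ (A B C E : ℝ) (c d : ℕ → ℝ) (f : ℝ × ℝ → ℝ) (p : ℝ × ℝ) : ℝ :=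
  reflExt A B c (fun x => reflExt C E d (fun y => f (x, y)) p.2) p.1

lemma reflExt₂_comm (c d : ℕ → ℝ) (f : ℝ × ℝ → ℝ) (p : ℝ × ℝ) : reflExt₂ A B C E c d f p
    = reflExt C E d (fun y => reflExt A B c (fun x => f (x, y)) p.1) p.2 := by
  simp only [reflExt₂, reflExt, Finset.mul_sum]
  rw [Finset.sum_comm]
  refine Finset.sum_congr rfl fun i _ => Finset.sum_congr rfl fun j _ => ?_
  ring

variable {c d : ℕ → ℝ} {f g : ℝ × ℝ → ℝ} {p : ℝ × ℝ}

lemma reflExt₂_of_mem (hc : ∑ i ∈ Finset.range 3, c i = 1) (hd : ∑ i ∈ Finset.range 3, d i = 1)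
    (hp : p ∈ Icc A B ×ˢ Icc C E) : reflExt₂ A B C E c d f p = f p := by
  rw [reflExt₂, reflExt_of_mem hc hp.1, reflExt_of_mem hd hp.2]

lemma continuousOn_reflExt₂ (hAB : A < B) (hCE : C < E) (hf : ContinuousOn f (Icc A B ×ˢ Icc C E)) :
    ContinuousOn (reflExt₂ A B C E c d f) (reflDom A B ×ˢ reflDom C E) := by
  unfold reflExt₂ reflExt
  refine continuousOn_finsetSum _ fun i hi => continuousOn_const.mul
    (continuousOn_finsetSum _ fun j hj => continuousOn_const.mul ?_)
  exact hf.comp (((continuous_reflPt.comp continuous_fst).prodMk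
    (continuous_reflPt.comp continuous_snd)).continuousOn)
    fun p hp => ⟨reflPt_mem hAB hp.1 hi, reflPt_mem hCE hp.2 hj⟩

lemma hasDerivAt_reflExt₂_u (hAB : A < B) (hCE : C < E) (hc : ∑ i ∈ Finset.range 3, c i = 1)
    (hc' : ∑ i ∈ Finset.range 3, reflCoef c i = 1)
    (h : ∀ x ∈ Icc A B, ∀ y ∈ Icc C E,
      HasDerivWithinAt (fun x' => f (x', y)) (g (x, y)) (Icc A B) x)
    (hp : p ∈ reflDom A B ×ˢ reflDom C E) :
    HasDerivAt (fun x => reflExt₂ A B C E c d f (x, p.2))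
      (reflExt₂ A B C E (reflCoef c) d g p) p.1 := by
  refine hasDerivAt_reflExt (f := fun x => reflExt C E d (fun y => f (x, y)) p.2)
    (f' := fun x => reflExt C E d (fun y => g (x, y)) p.2) hAB hc hc' (fun x hx => ?_) hp.1
  exact HasDerivWithinAt.fun_sum fun j hj => (h x hx _ (reflPt_mem hCE hp.2 hj)).const_mul (d j)

lemma hasDerivAt_reflExt₂_v (hAB : A < B) (hCE : C < E) (hd : ∑ i ∈ Finset.range 3, d i = 1)
    (hd' : ∑ i ∈ Finset.range 3, reflCoef d i = 1)
    (h : ∀ x ∈ Icc A B, ∀ y ∈ Icc C E,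
      HasDerivWithinAt (fun y' => f (x, y')) (g (x, y)) (Icc C E) y)
    (hp : p ∈ reflDom A B ×ˢ reflDom C E) :
    HasDerivAt (fun y => reflExt₂ A B C E c d f (p.1, y))
      (reflExt₂ A B C E c (reflCoef d) g p) p.2 := by
  simp only [reflExt₂_comm]
  refine hasDerivAt_reflExt (f := fun y => reflExt A B c (fun x => f (x, y)) p.1)
    (f' := fun y => reflExt A B c (fun x => g (x, y)) p.1) hCE hd hd' (fun y hy => ?_) hp.2
  exact HasDerivWithinAt.fun_sum fun j hj => (h _ (reflPt_mem hAB hp.1 hj) y hy).const_mul (c j)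

/-- The components of a jet are iterated one-sided partial derivatives on a closed rectangle. -/
structure Jet.IsJetRect (J : Jet) (A B C E : ℝ) : Prop where
  du : ∀ x ∈ Icc A B, ∀ y ∈ Icc C E,
    HasDerivWithinAt (fun x' => J.f (x', y)) (J.u (x, y)) (Icc A B) x
  dv : ∀ x ∈ Icc A B, ∀ y ∈ Icc C E,
    HasDerivWithinAt (fun y' => J.f (x, y')) (J.v (x, y)) (Icc C E) y
  duu : ∀ x ∈ Icc A B, ∀ y ∈ Icc C E,
    HasDerivWithinAt (fun x' => J.u (x', y)) (J.uu (x, y)) (Icc A B) x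
  duv : ∀ x ∈ Icc A B, ∀ y ∈ Icc C E,
    HasDerivWithinAt (fun y' => J.u (x, y')) (J.uv (x, y)) (Icc C E) y
  dvu : ∀ x ∈ Icc A B, ∀ y ∈ Icc C E,
    HasDerivWithinAt (fun x' => J.v (x', y)) (J.uv (x, y)) (Icc A B) x
  dvv : ∀ x ∈ Icc A B, ∀ y ∈ Icc C E,
    HasDerivWithinAt (fun y' => J.v (x, y')) (J.vv (x, y)) (Icc C E) y

/-- Reflection coefficients preserving `C²` regularity. -/
def reflC : ℕ → ℝ := fun i => if i = 0 then 3 else if i = 1 then -3 else 1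

lemma sum_reflC : ∑ i ∈ Finset.range 3, reflC i = 1 := by
  norm_num [Finset.sum_range_succ, reflC]

lemma sum_reflCoef_reflC : ∑ i ∈ Finset.range 3, reflCoef reflC i = 1 := by
  norm_num [Finset.sum_range_succ, reflC, reflCoef]

lemma sum_reflCoef_reflCoef_reflC :
    ∑ i ∈ Finset.range 3, reflCoef (reflCoef reflC) i = 1 := by
  norm_num [Finset.sum_range_succ, reflC, reflCoef]

/-- Extension of a jet from a closed rectangle to a neighbourhood. -/
def Jet.refl (J : Jet) (A B C E : ℝ) : Jet where
  f := reflExt₂ A B C E reflC reflC J.f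
  u := reflExt₂ A B C E (reflCoef reflC) reflC J.u
  v := reflExt₂ A B C E reflC (reflCoef reflC) J.v
  uu := reflExt₂ A B C E (reflCoef (reflCoef reflC)) reflC J.uu
  uv := reflExt₂ A B C E (reflCoef reflC) (reflCoef reflC) J.uv
  vv := reflExt₂ A B C E reflC (reflCoef (reflCoef reflC)) J.vv

lemma isOpen_reflDom_prod : IsOpen (reflDom A B ×ˢ reflDom C E) := isOpen_Ioo.prod isOpen_Ioo

lemma Icc_prod_subset_reflDom (hAB : A < B) (hCE : C < E) :
    Icc A B ×ˢ Icc C E ⊆ reflDom A B ×ˢ reflDom C E :=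
  prod_mono (Icc_subset_Ioo (by linarith) (by linarith))
    (Icc_subset_Ioo (by linarith) (by linarith))

namespace Jet

variable {J : Jet}

lemma IsJetRect.isJet_refl (h : J.IsJetRect A B C E) (hAB : A < B) (hCE : C < E) :
    (J.refl A B C E).IsJet (reflDom A B ×ˢ reflDom C E) where
  du _ hp := hasDerivAt_reflExt₂_u hAB hCE sum_reflC sum_reflCoef_reflC h.du hp
  dv _ hp := hasDerivAt_reflExt₂_v hAB hCE sum_reflC sum_reflCoef_reflC h.dv hp
  duu _ hp := hasDerivAt_reflExt₂_u hAB hCE sum_reflCoef_reflC sum_reflCoef_reflCoef_reflC h.duu hp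
  duv _ hp := hasDerivAt_reflExt₂_v hAB hCE sum_reflC sum_reflCoef_reflC h.duv hp
  dvu _ hp := hasDerivAt_reflExt₂_u hAB hCE sum_reflC sum_reflCoef_reflC h.dvu hp
  dvv _ hp := hasDerivAt_reflExt₂_v hAB hCE sum_reflCoef_reflC sum_reflCoef_reflCoef_reflC h.dvv hp

lemma ContOn.refl (h : J.ContOn (Icc A B ×ˢ Icc C E)) (hAB : A < B) (hCE : C < E) :
    (J.refl A B C E).ContOn (reflDom A B ×ˢ reflDom C E) where
  f := continuousOn_reflExt₂ hAB hCE h.f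
  u := continuousOn_reflExt₂ hAB hCE h.u
  v := continuousOn_reflExt₂ hAB hCE h.v
  uu := continuousOn_reflExt₂ hAB hCE h.uu
  uv := continuousOn_reflExt₂ hAB hCE h.uv
  vv := continuousOn_reflExt₂ hAB hCE h.vv

end Jet

/-- A function with `Cⁿ` partial derivatives on an open set is `Cⁿ⁺¹`. -/
lemma contDiffOn_succ_of_partial {O : Set (ℝ × ℝ)} (hO : IsOpen O) {n : ℕ} {f fu fv : ℝ × ℝ → ℝ}
    (hu : ∀ p ∈ O, HasDerivAt (fun x => f (x, p.2)) (fu p) p.1)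
    (hv : ∀ p ∈ O, HasDerivAt (fun y => f (p.1, y)) (fv p) p.2)
    (cu : ContDiffOn ℝ n fu O) (cv : ContDiffOn ℝ n fv O) : ContDiffOn ℝ (n + 1) f O := by
  rw [contDiffOn_succ_iff_hasFDerivWithinAt_of_uniqueDiffOn hO.uniqueDiffOn]
  refine ⟨fun h => absurd h (by simp), fun p => fu p • ContinuousLinearMap.fst ℝ ℝ ℝ
    + fv p • ContinuousLinearMap.snd ℝ ℝ ℝ,
    (cu.smul contDiffOn_const).add (cv.smul contDiffOn_const), fun p hp => ?_⟩
  have key := hasStrictFDerivAt_uncurry_coprod (𝕜 := ℝ) (u := p) (f := fun x y => f (x, y))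
    (f₁ := fun x y => (fu (x, y)) • ContinuousLinearMap.id ℝ ℝ)
    (f₂ := fun x y => (fv (x, y)) • ContinuousLinearMap.id ℝ ℝ) ?_ ?_ ?_ ?_
  · refine (HasFDerivAt.congr_fderiv key.hasFDerivAt ?_).hasFDerivWithinAt
    ext <;> simp [Function.HasUncurry.uncurry]
  · filter_upwards [hO.mem_nhds hp] with q hq
    refine (hu q hq).hasFDerivAt.congr_fderiv ?_
    ext; simp [Function.HasUncurry.uncurry]
  · filter_upwards [hO.mem_nhds hp] with q hq
    refine (hv q hq).hasFDerivAt.congr_fderiv ?_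
    ext; simp [Function.HasUncurry.uncurry]
  · exact (cu.continuousOn.continuousAt (hO.mem_nhds hp)).smul continuousAt_const
  · exact (cv.continuousOn.continuousAt (hO.mem_nhds hp)).smul continuousAt_const

lemma Jet.IsJet.contDiffOn {J : Jet} {O : Set (ℝ × ℝ)} (hO : IsOpen O) (h : J.IsJet O)
    (hc : J.ContOn O) : ContDiffOn ℝ 2 J.f O := by
  have hu := contDiffOn_succ_of_partial (n := 0) hO h.duu h.duv (by simpa using hc.uu)
    (by simpa using hc.uv)
  have hv := contDiffOn_succ_of_partial (n := 0) hO h.dvu h.dvv (by simpa using hc.uv)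
    (by simpa using hc.vv)
  have := contDiffOn_succ_of_partial (n := 1) hO h.du h.dv (by simpa using hu) (by simpa using hv)
  convert this using 1
  norm_num

end Reflection2

section Corner

lemma exists_tendsto_of_forall_eventually_abs_le {α : Type*} {F : Filter α} [F.NeBot] {g : α → ℝ}
    (h : ∀ ε > 0, ∃ c, ∀ᶠ p in F, |g p - c| ≤ ε) : ∃ L, Tendsto g F (𝓝 L) := by
  refine cauchy_map_iff_exists_tendsto.1 (Metric.cauchy_iff.2 ⟨inferInstance, fun ε hε => ?_⟩)
  obtain ⟨c, hc⟩ := h (ε / 3) (by positivity)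
  refine ⟨_, image_mem_map hc, ?_⟩
  rintro _ ⟨p, hp, rfl⟩ _ ⟨q, hq, rfl⟩
  rw [Real.dist_eq]
  simp only [mem_ofPred_eq, abs_le] at hp hq
  rw [abs_lt]
  constructor <;> linarith

variable {A B C E : ℝ} {f g : ℝ × ℝ → ℝ}

lemma neBot_nhdsWithin_corner (hAB : A < B) (hCE : C < E) :
    (𝓝[puncturedRect A B C E] (B, E)).NeBot := by
  rw [← mem_closure_iff_nhdsWithin_neBot]
  exact closure_mono Ioo_subset_puncturedRect (Icc_subset_closure_Ioo hAB hCE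
    ⟨⟨hAB.le, le_rfl⟩, ⟨hCE.le, le_rfl⟩⟩)

lemma exists_corner_limit_of_Bd_Dv (hAB : A < B) (hCE : C < E)
    (hg : ContDiffOn ℝ 1 g (puncturedRect A B C E))
    (h : Bd (puncturedRect A B C E) (Dv (puncturedRect A B C E) g)) :
    ∃ L, Tendsto g (𝓝[puncturedRect A B C E] (B, E)) (𝓝 L) := by
  have := neBot_nhdsWithin_corner hAB hCE
  refine exists_tendsto_of_forall_eventually_abs_le fun ε hε => ?_
  obtain ⟨M, hM⟩ := h
  have hM0 : 0 ≤ M := (abs_nonneg _).trans (hM (A, C)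
    (mem_puncturedRect.2 ⟨⟨le_rfl, hAB.le⟩, ⟨le_rfl, hCE.le⟩, Or.inl hAB⟩))
  obtain ⟨v, hv, hvE, hMv⟩ : ∃ v, C ≤ v ∧ v < E ∧ M * (E - v) ≤ ε / 2 := by
    refine ⟨max C (E - ε / (2 * (M + 1))), le_max_left _ _,
      max_lt hCE (sub_lt_self _ (by positivity)), ?_⟩
    have h1 : E - max C (E - ε / (2 * (M + 1))) ≤ ε / (2 * (M + 1)) := by
      linarith [le_max_right C (E - ε / (2 * (M + 1)))]
    refine (mul_le_mul_of_nonneg_left h1 hM0).trans ?_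
    rw [mul_div_assoc', div_le_div_iff₀ (by positivity) (by positivity)]
    nlinarith
  have hline : Tendsto (fun p : ℝ × ℝ => (p.1, v)) (𝓝[puncturedRect A B C E] (B, E))
      (𝓝[puncturedRect A B C E] (B, v)) := by
    refine tendsto_nhdsWithin_iff.2 ⟨?_, ?_⟩
    · exact (Continuous.tendsto (f := fun p : ℝ × ℝ => (p.1, v)) (by fun_prop) (B, E)).mono_left
        nhdsWithin_le_nhds
    · filter_upwards [self_mem_nhdsWithin] with p hp
      have hp := mem_puncturedRect.1 hp
      exact mem_puncturedRect.2 ⟨hp.1, ⟨hv, hvE.le⟩, Or.inr hvE⟩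
  have hlim := (hg.continuousOn (B, v) (mem_puncturedRect.2
    ⟨⟨hAB.le, le_rfl⟩, ⟨hv, hvE.le⟩, Or.inr hvE⟩)).tendsto.comp hline
  refine ⟨g (B, v), ?_⟩
  have hsnd : ∀ᶠ p : ℝ × ℝ in 𝓝[puncturedRect A B C E] (B, E), v < p.2 :=
    nhdsWithin_le_nhds (continuous_snd.continuousAt.eventually (lt_mem_nhds hvE))
  filter_upwards [hlim.eventually (Metric.closedBall_mem_nhds _ (half_pos hε)), hsnd,
    self_mem_nhdsWithin] with p h1 h2 hp
  have hm := mem_puncturedRect.1 hp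
  have e := integral_Dv hAB hCE hg hp hv h2.le
  have e2 := intervalIntegral.norm_integral_le_of_norm_le_const (a := v) (b := p.2) (C := M)
    (f := fun y => Dv (puncturedRect A B C E) g (p.1, y)) fun y hy => by
      rw [uIoc_of_le h2.le] at hy
      exact hM _ (mem_puncturedRect_of_le hp hm.1.1 le_rfl (hv.trans hy.1.le) hy.2)
  rw [e, Real.norm_eq_abs, abs_of_nonneg (sub_nonneg.2 h2.le)] at e2
  have e3 : M * (p.2 - v) ≤ M * (E - v) := mul_le_mul_of_nonneg_left (by linarith [hm.2.1.2]) hM0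
  simp only [Function.comp_apply, Real.dist_eq] at h1
  rw [abs_le] at *
  constructor <;> linarith

lemma exists_corner_limit_of_Bd_Du (hAB : A < B) (hCE : C < E)
    (hg : ContDiffOn ℝ 1 g (puncturedRect A B C E))
    (h : Bd (puncturedRect A B C E) (Du (puncturedRect A B C E) g)) :
    ∃ L, Tendsto g (𝓝[puncturedRect A B C E] (B, E)) (𝓝 L) := by
  have := neBot_nhdsWithin_corner hAB hCE
  refine exists_tendsto_of_forall_eventually_abs_le fun ε hε => ?_
  obtain ⟨M, hM⟩ := h
  have hM0 : 0 ≤ M := (abs_nonneg _).trans (hM (A, C)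
    (mem_puncturedRect.2 ⟨⟨le_rfl, hAB.le⟩, ⟨le_rfl, hCE.le⟩, Or.inl hAB⟩))
  obtain ⟨u, hu, huB, hMu⟩ : ∃ u, A ≤ u ∧ u < B ∧ M * (B - u) ≤ ε / 2 := by
    refine ⟨max A (B - ε / (2 * (M + 1))), le_max_left _ _,
      max_lt hAB (sub_lt_self _ (by positivity)), ?_⟩
    have h1 : B - max A (B - ε / (2 * (M + 1))) ≤ ε / (2 * (M + 1)) := by
      linarith [le_max_right A (B - ε / (2 * (M + 1)))]
    refine (mul_le_mul_of_nonneg_left h1 hM0).trans ?_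
    rw [mul_div_assoc', div_le_div_iff₀ (by positivity) (by positivity)]
    nlinarith
  have hline : Tendsto (fun p : ℝ × ℝ => (u, p.2)) (𝓝[puncturedRect A B C E] (B, E))
      (𝓝[puncturedRect A B C E] (u, E)) := by
    refine tendsto_nhdsWithin_iff.2 ⟨?_, ?_⟩
    · exact (Continuous.tendsto (f := fun p : ℝ × ℝ => (u, p.2)) (by fun_prop) (B, E)).mono_left
        nhdsWithin_le_nhds
    · filter_upwards [self_mem_nhdsWithin] with p hp
      have hp := mem_puncturedRect.1 hp
      exact mem_puncturedRect.2 ⟨⟨hu, huB.le⟩, hp.2.1, Or.inl huB⟩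
  have hlim := (hg.continuousOn (u, E) (mem_puncturedRect.2
    ⟨⟨hu, huB.le⟩, ⟨hCE.le, le_rfl⟩, Or.inl huB⟩)).tendsto.comp hline
  refine ⟨g (u, E), ?_⟩
  have hfst : ∀ᶠ p : ℝ × ℝ in 𝓝[puncturedRect A B C E] (B, E), u < p.1 :=
    nhdsWithin_le_nhds (continuous_fst.continuousAt.eventually (lt_mem_nhds huB))
  filter_upwards [hlim.eventually (Metric.closedBall_mem_nhds _ (half_pos hε)), hfst,
    self_mem_nhdsWithin] with p h1 h2 hp
  have hm := mem_puncturedRect.1 hp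
  have e := integral_Du hAB hCE hg hp hu h2.le
  have e2 := intervalIntegral.norm_integral_le_of_norm_le_const (a := u) (b := p.1) (C := M)
    (f := fun x => Du (puncturedRect A B C E) g (x, p.2)) fun x hx => by
      rw [uIoc_of_le h2.le] at hx
      exact hM _ (mem_puncturedRect_of_le hp (hu.trans hx.1.le) hx.2 hm.2.1.1 le_rfl)
  rw [e, Real.norm_eq_abs, abs_of_nonneg (sub_nonneg.2 h2.le)] at e2
  have e3 : M * (p.1 - u) ≤ M * (B - u) := mul_le_mul_of_nonneg_left (by linarith [hm.1.2]) hM0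
  simp only [Function.comp_apply, Real.dist_eq] at h1
  rw [abs_le] at *
  constructor <;> linarith

/-- Extension of a function to a corner by its limit along the punctured rectangle. -/
def cornerExt (A B C E : ℝ) (g : ℝ × ℝ → ℝ) : ℝ × ℝ → ℝ :=
  Function.update g (B, E) (limUnder (𝓝[puncturedRect A B C E] (B, E)) g)

lemma cornerExt_of_mem {p : ℝ × ℝ} (hp : p ∈ puncturedRect A B C E) :
    cornerExt A B C E g p = g p :=
  Function.update_of_ne hp.2 _ _

lemma continuousOn_cornerExt (hg : ContinuousOn g (puncturedRect A B C E))
    (h : ∃ L, Tendsto g (𝓝[puncturedRect A B C E] (B, E)) (𝓝 L)) :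
    ContinuousOn (cornerExt A B C E g) (Icc A B ×ˢ Icc C E) :=
  continuousOn_update_iff.2 ⟨hg, fun _ => tendsto_nhds_limUnder h⟩

lemma continuousOn_line_u (hf : ContinuousOn f (Icc A B ×ˢ Icc C E)) {y : ℝ} (hy : y ∈ Icc C E) :
    ContinuousOn (fun x => f (x, y)) (Icc A B) :=
  hf.comp (by fun_prop) fun _ hx => ⟨hx, hy⟩

lemma continuousOn_line_v (hf : ContinuousOn f (Icc A B ×ˢ Icc C E)) {x : ℝ} (hx : x ∈ Icc A B) :
    ContinuousOn (fun y => f (x, y)) (Icc C E) :=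
  hf.comp (by fun_prop) fun _ hy => ⟨hx, hy⟩

lemma hasDerivWithinAt_cornerExt_u (hg : ContDiffOn ℝ 1 g (puncturedRect A B C E))
    (hc : ContinuousOn (cornerExt A B C E g) (Icc A B ×ˢ Icc C E))
    (hf : ∀ p ∈ puncturedRect A B C E, f p = Du (puncturedRect A B C E) g p)
    (hc' : ContinuousOn (cornerExt A B C E f) (Icc A B ×ˢ Icc C E)) :
    ∀ x ∈ Icc A B, ∀ y ∈ Icc C E, HasDerivWithinAt (fun x' => cornerExt A B C E g (x', y))
      (cornerExt A B C E f (x, y)) (Icc A B) x := by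
  intro x hx y hy
  refine hasDerivWithinAt_Icc_of_continuousOn (f' := fun x => cornerExt A B C E f (x, y))
    (continuousOn_line_u hc hy) (continuousOn_line_u hc' hy) (fun z hz => ?_) hx
  have hmem : ∀ w ∈ Ioo A B, (w, y) ∈ puncturedRect A B C E := fun w hw =>
    mem_puncturedRect.2 ⟨⟨hw.1.le, hw.2.le⟩, hy, Or.inl hw.2⟩
  simp only [cornerExt_of_mem (hmem z hz), hf _ (hmem z hz)]
  have h1 := (hasDerivWithinAt_Du hg (hmem z hz)).hasDerivAt
    (mem_of_superset (Ioo_mem_nhds hz.1 hz.2) hmem)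
  refine h1.congr_of_eventuallyEq ?_
  filter_upwards [Ioo_mem_nhds hz.1 hz.2] with w hw using cornerExt_of_mem (hmem w hw)

lemma hasDerivWithinAt_cornerExt_v (hg : ContDiffOn ℝ 1 g (puncturedRect A B C E))
    (hc : ContinuousOn (cornerExt A B C E g) (Icc A B ×ˢ Icc C E))
    (hf : ∀ p ∈ puncturedRect A B C E, f p = Dv (puncturedRect A B C E) g p)
    (hc' : ContinuousOn (cornerExt A B C E f) (Icc A B ×ˢ Icc C E)) :
    ∀ x ∈ Icc A B, ∀ y ∈ Icc C E, HasDerivWithinAt (fun y' => cornerExt A B C E g (x, y'))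
      (cornerExt A B C E f (x, y)) (Icc C E) y := by
  intro x hx y hy
  refine hasDerivWithinAt_Icc_of_continuousOn (f' := fun y => cornerExt A B C E f (x, y))
    (continuousOn_line_v hc hx) (continuousOn_line_v hc' hx) (fun z hz => ?_) hy
  have hmem : ∀ w ∈ Ioo C E, (x, w) ∈ puncturedRect A B C E := fun w hw =>
    mem_puncturedRect.2 ⟨hx, ⟨hw.1.le, hw.2.le⟩, Or.inr hw.2⟩
  simp only [cornerExt_of_mem (hmem z hz), hf _ (hmem z hz)]
  have h1 := (hasDerivWithinAt_Dv hg (hmem z hz)).hasDerivAt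
    (mem_of_superset (Ioo_mem_nhds hz.1 hz.2) hmem)
  refine h1.congr_of_eventuallyEq ?_
  filter_upwards [Ioo_mem_nhds hz.1 hz.2] with w hw using cornerExt_of_mem (hmem w hw)

/-- Extension of the components of a jet to a corner. -/
def Jet.corner (J : Jet) (A B C E : ℝ) : Jet where
  f := cornerExt A B C E J.f
  u := cornerExt A B C E J.u
  v := cornerExt A B C E J.v
  uu := cornerExt A B C E J.uu
  uv := cornerExt A B C E J.uv
  vv := cornerExt A B C E J.vv

lemma Jet.ContOn.mono {J : Jet} {S T : Set (ℝ × ℝ)} (h : J.ContOn T) (hST : S ⊆ T) : J.ContOn S :=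
  ⟨h.f.mono hST, h.u.mono hST, h.v.mono hST, h.uu.mono hST, h.uv.mono hST, h.vv.mono hST⟩

/-- Two jets agree on a set. -/
structure Jet.EqOn (J K : Jet) (S : Set (ℝ × ℝ)) : Prop where
  f : Set.EqOn J.f K.f S
  u : Set.EqOn J.u K.u S
  v : Set.EqOn J.v K.v S
  uu : Set.EqOn J.uu K.uu S
  uv : Set.EqOn J.uv K.uv S
  vv : Set.EqOn J.vv K.vv S

lemma JetEKG.congr {a l : ℝ} {r ω φ r' ω' φ' : Jet} {S : Set (ℝ × ℝ)} (hr : r'.EqOn r S)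
    (hω : ω'.EqOn ω S) (hφ : φ'.EqOn φ S) {p : ℝ × ℝ} (hp : p ∈ S) (h : JetEKG a l r ω φ p) :
    JetEKG a l r' ω' φ' p := by
  obtain ⟨h1, h2, h3, h4, h5⟩ := h
  constructor <;>
  simpa only [hr.f hp, hr.u hp, hr.v hp, hr.uu hp, hr.uv hp, hr.vv hp, hω.f hp, hω.u hp, hω.v hp,
    hω.uv hp, hφ.f hp, hφ.u hp, hφ.v hp, hφ.uv hp]

/-- The `C²` extension of a function across the corner of a punctured rectangle. -/
def extJet (A B C E : ℝ) (f : ℝ × ℝ → ℝ) : Jet :=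
  ((jetWithin (puncturedRect A B C E) f).corner A B C E).refl A B C E

lemma extJet_eqOn : (extJet A B C E f).EqOn (jetWithin (puncturedRect A B C E) f)
    (puncturedRect A B C E) where
  f _ hp := (reflExt₂_of_mem sum_reflC sum_reflC hp.1).trans (cornerExt_of_mem hp)
  u _ hp := (reflExt₂_of_mem sum_reflCoef_reflC sum_reflC hp.1).trans (cornerExt_of_mem hp)
  v _ hp := (reflExt₂_of_mem sum_reflC sum_reflCoef_reflC hp.1).trans (cornerExt_of_mem hp)
  uu _ hp := (reflExt₂_of_mem sum_reflCoef_reflCoef_reflC sum_reflC hp.1).trans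
    (cornerExt_of_mem hp)
  uv _ hp := (reflExt₂_of_mem sum_reflCoef_reflC sum_reflCoef_reflC hp.1).trans
    (cornerExt_of_mem hp)
  vv _ hp := (reflExt₂_of_mem sum_reflC sum_reflCoef_reflCoef_reflC hp.1).trans
    (cornerExt_of_mem hp)

end Corner

namespace InteriorSol

variable {a l A B C E r₀ R : ℝ} {r ω φ f : ℝ × ℝ → ℝ}

local notation "𝔇" => puncturedRect A B C E

lemma extJet_spec (h : InteriorSol a l A B C E r₀ R r ω φ) (hf : ContDiffOn ℝ 3 f 𝔇)
    (hfb : C1B 𝔇 f) (hfm : C1B 𝔇 (Dv 𝔇 (Du 𝔇 f))) :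
    (extJet A B C E f).IsJet (reflDom A B ×ˢ reflDom C E) ∧
      (extJet A B C E f).ContOn (reflDom A B ×ˢ reflDom C E) := by
  have hD := h.uniqueDiffOn
  have hAB := h.lt_u
  have hCE := h.lt_v
  obtain ⟨hu, hv⟩ := h.C1B_of_mixed hf hfm
  have hu2 := h.contDiffOn_Du hf
  have hv2 := h.contDiffOn_Dv hf
  have huu : ContDiffOn ℝ 1 (Du 𝔇 (Du 𝔇 f)) 𝔇 := hu2.Du_of_le hD (by norm_num)
  have hvv : ContDiffOn ℝ 1 (Dv 𝔇 (Dv 𝔇 f)) 𝔇 := hv2.Dv_of_le hD (by norm_num)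
  have key : ∀ {g}, C1B 𝔇 g → ContinuousOn (cornerExt A B C E g) (Icc A B ×ˢ Icc C E) :=
    fun hg => continuousOn_cornerExt hg.contDiffOn.continuousOn
      (exists_corner_limit_of_Bd_Dv hAB hCE hg.contDiffOn hg.bd_v)
  have cuu : ContinuousOn (cornerExt A B C E (Du 𝔇 (Du 𝔇 f))) (Icc A B ×ˢ Icc C E) :=
    continuousOn_cornerExt huu.continuousOn (exists_corner_limit_of_Bd_Dv hAB hCE huu
      (hfm.bd_u.congr fun p hp => (h.comm hu2 hp).symm))
  have cvv : ContinuousOn (cornerExt A B C E (Dv 𝔇 (Dv 𝔇 f))) (Icc A B ×ˢ Icc C E) :=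
    continuousOn_cornerExt hvv.continuousOn (exists_corner_limit_of_Bd_Du hAB hCE hvv
      (hfm.bd_v.congr fun p hp => by
        rw [h.comm hv2 hp]
        exact Dv_congr (fun q hq => h.comm (hf.of_le (by norm_num)) hq) hp))
  have hc : ((jetWithin 𝔇 f).corner A B C E).ContOn (Icc A B ×ˢ Icc C E) :=
    ⟨key hfb, key hu, key hv, cuu, key hfm, cvv⟩
  have hj : ((jetWithin 𝔇 f).corner A B C E).IsJetRect A B C E :=
    ⟨hasDerivWithinAt_cornerExt_u hfb.contDiffOn hc.f (fun _ _ => rfl) hc.u,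
      hasDerivWithinAt_cornerExt_v hfb.contDiffOn hc.f (fun _ _ => rfl) hc.v,
      hasDerivWithinAt_cornerExt_u hu.contDiffOn hc.u (fun _ _ => rfl) hc.uu,
      hasDerivWithinAt_cornerExt_v hu.contDiffOn hc.u (fun _ _ => rfl) hc.uv,
      hasDerivWithinAt_cornerExt_u hv.contDiffOn hc.v
        (fun p hp => (h.comm (hf.of_le (by norm_num)) hp).symm) hc.uv,
      hasDerivWithinAt_cornerExt_v hv.contDiffOn hc.v (fun _ _ => rfl) hc.vv⟩
  exact ⟨hj.isJet_refl hAB hCE, hc.refl hAB hCE⟩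

/-- A solution extends across the corner as a `C²` solution. -/
theorem exists_extension (h : InteriorSol a l A B C E r₀ R r ω φ) :
    ∃ r' Ω' φ' : ℝ × ℝ → ℝ, ContDiffOn ℝ 2 r' (Icc A B ×ˢ Icc C E) ∧
      ContDiffOn ℝ 2 Ω' (Icc A B ×ˢ Icc C E) ∧ ContDiffOn ℝ 2 φ' (Icc A B ×ˢ Icc C E) ∧
      EKG a l (Icc A B ×ˢ Icc C E) r' Ω' φ' ∧
      EqOn r' r 𝔇 ∧ EqOn Ω' (fun p => exp (ω p)) 𝔇 ∧ EqOn φ' φ 𝔇 := by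
  obtain ⟨jr, cr⟩ := h.extJet_spec h.contDiffOn_r h.C1B_r h.C1B_Dv_Du_r
  obtain ⟨jω, cω⟩ := h.extJet_spec h.contDiffOn_ω h.C1B_ω h.C1B_Dv_Du_ω
  obtain ⟨jφ, cφ⟩ := h.extJet_spec h.contDiffOn_φ h.C1B_φ h.C1B_Dv_Du_φ
  have hO : IsOpen (reflDom A B ×ˢ reflDom C E) := isOpen_reflDom_prod
  have hKO := Icc_prod_subset_reflDom h.lt_u h.lt_v
  have hDK : 𝔇 ⊆ Icc A B ×ˢ Icc C E := puncturedRect_subset_Icc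
  have hKD : Icc A B ×ˢ Icc C E ⊆ closure 𝔇 :=
    (Icc_subset_closure_Ioo h.lt_u h.lt_v).trans (closure_mono Ioo_subset_puncturedRect)
  have hpos : ∀ p ∈ Icc A B ×ˢ Icc C E, 0 < (extJet A B C E r).f p := by
    intro p hp
    refine h.r₀_pos.trans_le ?_
    have hcl := ((cr.mono hKO).f p hp).mono hDK
    have hsub : (extJet A B C E r).f '' 𝔇 ⊆ Ici r₀ := by
      rintro _ ⟨q, hq, rfl⟩
      exact (h.le_r q hq).trans_eq (extJet_eqOn.f hq).symm
    exact closure_minimal hsub isClosed_Ici (hcl.mem_closure_image (hKD hp))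
  refine ⟨(extJet A B C E r).f, fun p => exp ((extJet A B C E ω).f p), (extJet A B C E φ).f,
    (jr.contDiffOn hO cr).mono hKO, ((jω.contDiffOn hO cω).mono hKO).exp,
    (jφ.contDiffOn hO cφ).mono hKO, (EKG_iff hO hKO jr jω jφ (fun _ _ => rfl) hpos).2 ?_,
    extJet_eqOn.f, fun p hp => congrArg exp (extJet_eqOn.f hp), extJet_eqOn.f⟩
  exact JetEKG.of_closure hDK hKD (cr.mono hKO) (cω.mono hKO) (cφ.mono hKO)
    (fun p hp => (hpos p hp).ne')
    fun p hp => (h.sys p hp).congr extJet_eqOn extJet_eqOn extJet_eqOn hp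

end InteriorSol

section PartialDerivatives

variable {A B C E : ℝ} {f : ℝ × ℝ → ℝ} {p : ℝ × ℝ}

lemma abs_pdu_le (hAB : A < B) (hf : ContDiffOn ℝ 1 f (puncturedRect A B C E))
    (hp : p ∈ puncturedRect A B C E) : |pdu f p| ≤ |Du (puncturedRect A B C E) f p| := by
  by_cases hd : DifferentiableAt ℝ (fun x => f (x, p.2)) p.1
  · have hm := mem_puncturedRect.1 hp
    have hsub : Icc A B \ {B} ⊆ {x | (x, p.2) ∈ puncturedRect A B C E} := fun x hx =>
      mem_puncturedRect.2 ⟨hx.1, hm.2.1, Or.inl (lt_of_le_of_ne hx.1.2 hx.2)⟩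
    have hu : UniqueDiffWithinAt ℝ (Icc A B \ {B}) p.1 := by
      rw [Icc_sdiff_right]
      refine (uniqueDiffWithinAt_convex (convex_Ico A B) (by simpa using hAB) ?_)
      rw [closure_Ico hAB.ne]
      exact hm.1
    have e := hu.eq_deriv _ (hd.hasDerivAt.hasDerivWithinAt) ((hasDerivWithinAt_Du hf hp).mono hsub)
    exact (congrArg abs e).le
  · rw [pdu, deriv_zero_of_not_differentiableAt hd, abs_zero]
    exact abs_nonneg _

lemma abs_pdv_le (hCE : C < E) (hf : ContDiffOn ℝ 1 f (puncturedRect A B C E))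
    (hp : p ∈ puncturedRect A B C E) : |pdv f p| ≤ |Dv (puncturedRect A B C E) f p| := by
  by_cases hd : DifferentiableAt ℝ (fun y => f (p.1, y)) p.2
  · have hm := mem_puncturedRect.1 hp
    have hsub : Icc C E \ {E} ⊆ {y | (p.1, y) ∈ puncturedRect A B C E} := fun y hy =>
      mem_puncturedRect.2 ⟨hm.1, hy.1, Or.inr (lt_of_le_of_ne hy.1.2 hy.2)⟩
    have hu : UniqueDiffWithinAt ℝ (Icc C E \ {E}) p.2 := by
      rw [Icc_sdiff_right]
      refine (uniqueDiffWithinAt_convex (convex_Ico C E) (by simpa using hCE) ?_)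
      rw [closure_Ico hCE.ne]
      exact hm.2.1
    have e := hu.eq_deriv _ (hd.hasDerivAt.hasDerivWithinAt) ((hasDerivWithinAt_Dv hf hp).mono hsub)
    exact (congrArg abs e).le
  · rw [pdv, deriv_zero_of_not_differentiableAt hd, abs_zero]
    exact abs_nonneg _

end PartialDerivatives

/-- **Proposition A.1 (extension principle in the interior).**
A `C³` solution of the Einstein–Klein–Gordon system on the punctured rectangle
`𝒟 = [U',U] × [V',V] \ {(U,V)}` with finite spacetime volume, area radius bounded above
and below, and uniform bounds on the two past edges, has uniformly bounded
`rφ, log Ω², r r_v, r r_u` and extends to a `C²` solution on the full closed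
rectangle. -/
theorem stmt_18 (a l : ℝ) (hl : 0 < l) (U' U V' V : ℝ) (hU : U' < U) (hV : V' < V)
    (r Ω φ : ℝ × ℝ → ℝ)
    (𝒟 : Set (ℝ × ℝ)) (h𝒟 : 𝒟 = (Set.Icc U' U ×ˢ Set.Icc V' V) \ {(U, V)})
    (hr : ContDiffOn ℝ 3 r 𝒟) (hΩ : ContDiffOn ℝ 3 Ω 𝒟) (hφ : ContDiffOn ℝ 3 φ 𝒟)
    (hsys : EKG a l 𝒟 r Ω φ)
    (hru : ∀ p ∈ 𝒟, pdu r p < 0)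
    -- (i) finite spacetime volume
    (hvol : ∃ Cvol : ℝ, (∫ p in 𝒟, (Ω p) ^ 2) ≤ Cvol ∧
      MeasureTheory.IntegrableOn (fun p => (Ω p) ^ 2) 𝒟)
    -- (ii) bounds on the area radius
    (r₀ R : ℝ) (hr₀ : 0 < r₀) (hbounds : ∀ p ∈ 𝒟, r₀ ≤ r p ∧ r p ≤ R)
    -- (iii) bounds on the past edges
    (N : ℝ) (hN : 0 < N)
    (hedge : ∀ p ∈ (Set.Icc U' U ×ˢ ({V'} : Set ℝ)) ∪ (({U'} : Set ℝ) ×ˢ Set.Icc V' V),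
      (1 / N < -(r p * pdu r p) ∧ -(r p * pdu r p) < N) ∧
      |r p * pdv r p| < N ∧
      |r p * φ p| + |r p * pdv φ p| + |r p * pdu φ p|
        + |pdu (fun q => pdu φ q) p| + |pdv (fun q => pdu φ q) p| < N ∧
      |pdv (fun q => pdu r q) p| + |pdu (fun q => pdu r q) p|
        + |pdv (fun q => pdv r q) p| + |pdu Ω p| + |pdv Ω p|
        + |Real.log ((Ω p) ^ 2)| < N)
    (hedgeint : (∫ y in Set.Ioc V' V,
        (pdv (fun q => pdu φ q + pdv φ q) (U', y)) ^ 2) < N) :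
    -- conclusions
    (∃ B : ℝ, ∀ p ∈ 𝒟,
      |r p * φ p| + |Real.log ((Ω p) ^ 2)| + |r p * pdv r p| + |r p * pdu r p| ≤ B) ∧
    ∃ r' Ω' φ' : ℝ × ℝ → ℝ,
      ContDiffOn ℝ 2 r' (Set.Icc U' U ×ˢ Set.Icc V' V) ∧
      ContDiffOn ℝ 2 Ω' (Set.Icc U' U ×ˢ Set.Icc V' V) ∧
      ContDiffOn ℝ 2 φ' (Set.Icc U' U ×ˢ Set.Icc V' V) ∧
      EKG a l (Set.Icc U' U ×ˢ Set.Icc V' V) r' Ω' φ' ∧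
      Set.EqOn r' r 𝒟 ∧ Set.EqOn Ω' Ω 𝒟 ∧ Set.EqOn φ' φ 𝒟 := by
  have h𝒟' : 𝒟 = puncturedRect U' U V' V := h𝒟
  clear h𝒟
  subst h𝒟'
  have hΩ' : ∀ p ∈ puncturedRect U' U V' V, exp (log (Ω p)) = Ω p := fun p hp =>
    exp_log (hsys.Ω_pos p hp)
  have h : InteriorSol a l U' U V' V r₀ R r (fun q => log (Ω q)) φ :=
    { lt_u := hU
      lt_v := hV
      l_ne := hl.ne'
      contDiffOn_r := hr
      contDiffOn_ω := hΩ.log fun p hp => (hsys.Ω_pos p hp).ne'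
      contDiffOn_φ := hφ
      sys := hsys.jetEKG hU hV (hr.of_le (by norm_num)) (hΩ.of_le (by norm_num))
        (hφ.of_le (by norm_num))
      r₀_pos := hr₀
      le_r := fun p hp => (hbounds p hp).1
      r_le := fun p hp => (hbounds p hp).2
      vol := by
        obtain ⟨_, _, hi⟩ := hvol
        refine hi.congr_fun (fun p hp => ?_)
          ((measurableSet_Icc.prod measurableSet_Icc).diff (measurableSet_singleton _))
        simp only [hΩ' p hp] }
  constructor
  · obtain ⟨M₁, h₁⟩ := h.bd_mul_φ
    obtain ⟨M₂, h₂⟩ := h.bd_ω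
    obtain ⟨M₃, h₃⟩ := h.bd_r.mul h.bd_Dv_r
    obtain ⟨M₄, h₄⟩ := h.bd_r.mul h.bd_Du_r
    refine ⟨M₁ + 2 * M₂ + M₃ + M₄, fun p hp => ?_⟩
    have e₂ : |log (Ω p ^ 2)| = 2 * |log (Ω p)| := by
      rw [log_pow, abs_mul]
      norm_num
    have e₃ : |r p * pdv r p| ≤ |r p * Dv (puncturedRect U' U V' V) r p| := by
      rw [abs_mul, abs_mul]
      exact mul_le_mul_of_nonneg_left (abs_pdv_le hV h.C1B_r.contDiffOn hp) (abs_nonneg _)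
    have e₄ : |r p * pdu r p| ≤ |r p * Du (puncturedRect U' U V' V) r p| := by
      rw [abs_mul, abs_mul]
      exact mul_le_mul_of_nonneg_left (abs_pdu_le hU h.C1B_r.contDiffOn hp) (abs_nonneg _)
    linarith [h₁ p hp, h₂ p hp, h₃ p hp, h₄ p hp]
  · obtain ⟨r', Ω', φ', c₁, c₂, c₃, hs, e₁, e₂, e₃⟩ := h.exists_extension
    exact ⟨r', Ω', φ', c₁, c₂, c₃, hs, e₁, fun p hp => (e₂ hp).trans (hΩ' p hp), e₃⟩
end
end

section
/- Let (r, Ω, φ) be a solution of the system (E1)–(E5) on an open domain in ℝ², with r ∈ C², Ω ∈ C² and φ ∈ C². Then the renormalized Hawking mass ϖ = (r/2)(1 + 4 r_u r_v/Ω²) + r³/(2l²) satisfies the identities ∂_u ϖ = −8π r² (r_v/Ω²) (∂_u φ)² + (4π r² a/l²) r_u φ² and ∂_v ϖ = −8π r² (r_u/Ω²) (∂_v φ)² + (4π r² a/l²) r_v φ². -/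
open Real Set Filter MeasureTheory Topology

noncomputable section

lemma hasDerivAt_pdu {f : ℝ × ℝ → ℝ} {p : ℝ × ℝ} (hf : DifferentiableAt ℝ f p) :
    HasDerivAt (fun x => f (x, p.2)) (pdu f p) p.1 := by
  have hline : DifferentiableAt ℝ (fun x : ℝ => (x, p.2)) p.1 := by fun_prop
  exact (DifferentiableAt.comp (g := f) p.1 hf hline).hasDerivAt

lemma hasDerivAt_pdv {f : ℝ × ℝ → ℝ} {p : ℝ × ℝ} (hf : DifferentiableAt ℝ f p) :
    HasDerivAt (fun y => f (p.1, y)) (pdv f p) p.2 := by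
  have hline : DifferentiableAt ℝ (fun y : ℝ => (p.1, y)) p.2 := by fun_prop
  exact (DifferentiableAt.comp (g := f) p.2 hf hline).hasDerivAt

lemma pdu_eq_fderiv {f : ℝ × ℝ → ℝ} {p : ℝ × ℝ} (hf : DifferentiableAt ℝ f p) :
    pdu f p = fderiv ℝ f p (1, 0) :=
  (HasFDerivAt.comp_hasDerivAt (l := f) p.1 hf.hasFDerivAt
    ((hasDerivAt_id p.1).prodMk (hasDerivAt_const p.1 p.2))).deriv

lemma pdv_eq_fderiv {f : ℝ × ℝ → ℝ} {p : ℝ × ℝ} (hf : DifferentiableAt ℝ f p) :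
    pdv f p = fderiv ℝ f p (0, 1) :=
  (HasFDerivAt.comp_hasDerivAt (l := f) p.2 hf.hasFDerivAt
    ((hasDerivAt_const p.2 p.1).prodMk (hasDerivAt_id p.2))).deriv

lemma ContDiffAt.eventually_differentiableAt {f : ℝ × ℝ → ℝ} {p : ℝ × ℝ}
    (hf : ContDiffAt ℝ 2 f p) : ∀ᶠ q in 𝓝 p, DifferentiableAt ℝ f q :=
  (hf.eventually (by simp)).mono fun _ hq => hq.differentiableAt (by simp)

lemma ContDiffAt.pdu_eventuallyEq {f : ℝ × ℝ → ℝ} {p : ℝ × ℝ} (hf : ContDiffAt ℝ 2 f p) :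
    pdu f =ᶠ[𝓝 p] fun q => fderiv ℝ f q (1, 0) :=
  hf.eventually_differentiableAt.mono fun _ => pdu_eq_fderiv

lemma ContDiffAt.pdv_eventuallyEq {f : ℝ × ℝ → ℝ} {p : ℝ × ℝ} (hf : ContDiffAt ℝ 2 f p) :
    pdv f =ᶠ[𝓝 p] fun q => fderiv ℝ f q (0, 1) :=
  hf.eventually_differentiableAt.mono fun _ => pdv_eq_fderiv

lemma ContDiffAt.differentiableAt_fderiv {f : ℝ × ℝ → ℝ} {p : ℝ × ℝ}
    (hf : ContDiffAt ℝ 2 f p) : DifferentiableAt ℝ (fderiv ℝ f) p :=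
  (hf.fderiv_right (m := 1) (by norm_num)).differentiableAt (by simp)

lemma ContDiffAt.differentiableAt_pdu {f : ℝ × ℝ → ℝ} {p : ℝ × ℝ} (hf : ContDiffAt ℝ 2 f p) :
    DifferentiableAt ℝ (pdu f) p :=
  (hf.differentiableAt_fderiv.clm_apply (differentiableAt_const _)).congr_of_eventuallyEq
    hf.pdu_eventuallyEq

lemma ContDiffAt.differentiableAt_pdv {f : ℝ × ℝ → ℝ} {p : ℝ × ℝ} (hf : ContDiffAt ℝ 2 f p) :
    DifferentiableAt ℝ (pdv f) p :=
  (hf.differentiableAt_fderiv.clm_apply (differentiableAt_const _)).congr_of_eventuallyEq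
    hf.pdv_eventuallyEq

/-- Mixed null derivatives of a `C²` function commute. -/
lemma ContDiffAt.pdu_pdv_comm {f : ℝ × ℝ → ℝ} {p : ℝ × ℝ} (hf : ContDiffAt ℝ 2 f p) :
    pdu (pdv f) p = pdv (pdu f) p := by
  have hd := hf.differentiableAt_fderiv
  rw [pdu_eq_fderiv hf.differentiableAt_pdv, pdv_eq_fderiv hf.differentiableAt_pdu,
    hf.pdv_eventuallyEq.fderiv_eq, hf.pdu_eventuallyEq.fderiv_eq,
    fderiv_clm_apply hd (differentiableAt_const _),
    fderiv_clm_apply hd (differentiableAt_const _)]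
  simpa using (hf.isSymmSndFDerivAt (by simp)).eq (1, 0) (0, 1)

/-- **Evolution equations (2.13)–(2.14) for the renormalized Hawking mass.**
For any `C²` solution of the spherically symmetric Einstein–Klein–Gordon system with
`Λ = -3/l²` on an open domain,
`∂_u ϖ = -8π r² (r_v/Ω²)(∂_u φ)² + (4π r² a/l²) r_u φ²` and
`∂_v ϖ = -8π r² (r_u/Ω²)(∂_v φ)² + (4π r² a/l²) r_v φ²`. -/
theorem stmt_19 (a l : ℝ) (hl : 0 < l) (S : Set (ℝ × ℝ)) (hS : IsOpen S)
    (r Ω φ : ℝ × ℝ → ℝ)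
    (hr : ContDiffOn ℝ 2 r S) (hΩ : ContDiffOn ℝ 2 Ω S) (hφ : ContDiffOn ℝ 2 φ S)
    (hsys : EKG a l S r Ω φ) :
    ∀ p ∈ S,
      pdu (hawk l r Ω) p
        = -8 * π * (r p) ^ 2 * (pdv r p / (Ω p) ^ 2) * (pdu φ p) ^ 2
          + (4 * π * (r p) ^ 2 * a / l ^ 2) * pdu r p * (φ p) ^ 2 ∧
      pdv (hawk l r Ω) p
        = -8 * π * (r p) ^ 2 * (pdu r p / (Ω p) ^ 2) * (pdv φ p) ^ 2
          + (4 * π * (r p) ^ 2 * a / l ^ 2) * pdv r p * (φ p) ^ 2 := by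
  intro p hp
  have hrp := hr.contDiffAt (hS.mem_nhds hp)
  have hΩp := (hΩ.contDiffAt (hS.mem_nhds hp)).differentiableAt (by simp)
  have hrd := hrp.differentiableAt (by simp)
  have hr0 := (hsys.r_pos p hp).ne'
  have hΩ0 := (hsys.Ω_pos p hp).ne'
  have hΩ2 : Ω p ^ 2 ≠ 0 := pow_ne_zero 2 hΩ0
  have hl0 := hl.ne'
  have hruv : pdv (pdu r) p = _ := hsys.E3 p hp
  have hrvu : pdu (pdv r) p = _ := hrp.pdu_pdv_comm.trans hruv
  constructor
  · have hquot : DifferentiableAt ℝ (fun q => pdu r q / Ω q ^ 2) p := by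
      simpa only [div_eq_mul_inv] using hrp.differentiableAt_pdu.fun_mul ((hΩp.fun_pow 2).fun_inv hΩ2)
    have h := (((hasDerivAt_pdu hrd).div_const 2).mul
      ((((hasDerivAt_pdu hquot).mul (hasDerivAt_pdu hrp.differentiableAt_pdv)).const_mul
        4).const_add 1)).add (((hasDerivAt_pdu hrd).pow 3).div_const (2 * l ^ 2))
    have hfun : (fun x => hawk l r Ω (x, p.2)) = fun x => r (x, p.2) / 2 *
        (1 + 4 * (pdu r (x, p.2) / Ω (x, p.2) ^ 2 * pdv r (x, p.2)))
          + r (x, p.2) ^ 3 / (2 * l ^ 2) := by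
      funext x
      simp only [hawk]
      ring
    rw [pdu, hfun]
    refine h.deriv.trans ?_
    simp only [Pi.mul_apply, Prod.mk.eta]
    rw [hsys.E1 p hp, hrvu]
    field_simp
    ring
  · have hquot : DifferentiableAt ℝ (fun q => pdv r q / Ω q ^ 2) p := by
      simpa only [div_eq_mul_inv] using hrp.differentiableAt_pdv.fun_mul ((hΩp.fun_pow 2).fun_inv hΩ2)
    have h := (((hasDerivAt_pdv hrd).div_const 2).mul
      ((((hasDerivAt_pdv hquot).mul (hasDerivAt_pdv hrp.differentiableAt_pdu)).const_mul
        4).const_add 1)).add (((hasDerivAt_pdv hrd).pow 3).div_const (2 * l ^ 2))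
    have hfun : (fun y => hawk l r Ω (p.1, y)) = fun y => r (p.1, y) / 2 *
        (1 + 4 * (pdv r (p.1, y) / Ω (p.1, y) ^ 2 * pdu r (p.1, y)))
          + r (p.1, y) ^ 3 / (2 * l ^ 2) := by
      funext y
      simp only [hawk]
      ring
    rw [pdv, hfun]
    refine h.deriv.trans ?_
    simp only [Pi.mul_apply, Prod.mk.eta]
    rw [hsys.E2 p hp, hruv]
    field_simp
    ring
end
end
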